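/- arXiv:2511.03814 — 4 statements merged into one kernel-verified Lean document; each statement's English description precedes it below -/
import Mathlib

section
/- For every k ≥ 3 and all integers n₁ ≥ 2, n_k ≥ 2, and n_i ≥ 3 for 2 ≤ i ≤ k−1, there exist languages L₁,…,L_k over an alphabet with exactly k letters such that each L_i is accepted by a DFA with n_i states, while every DFA accepting the concatenation L₁L₂⋯L_k has at least B(n₁,…,n_k) states. -/
/-- Downward recursion with base `U = 2^{n_k}`, `V = 2^{n_k−1}` at the last index. -/
def UV : List ℕ → ℕ × ℕ
  | [] => (1, 1)
  | [m] => (2 ^ m, 2 ^ (m - 1))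
  | m :: rest =>
      (1 + (2 ^ (m - 1) - 1) * (UV rest).1 + 2 ^ (m - 1) * (UV rest).2,
       2 ^ (m - 2) * ((UV rest).1 + (UV rest).2))

/-- `B(n₁,…,n_k) = (n₁−1)·U₂ + V₂`, where `rest = [n₂,…,n_k]`. -/
def Bval (n1 : ℕ) (rest : List ℕ) : ℕ := (n1 - 1) * (UV rest).1 + (UV rest).2

namespace ConcatWitness

/-- Transition of letter `j` in the `i`-th automaton, whose states are `0, …, n i - 1`. -/
def trans (k : ℕ) (n : ℕ → ℕ) (i j q : ℕ) : ℕ :=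
  if j = i then (if j + 1 = k ∧ q = 0 then 0 else if q + 1 = n i then 0 else q + 1)
  else if j = i + 1 then (if q + 1 = n i ∧ 1 ≤ i then 0 else q)
  else if i = j + 1 ∧ i + 1 = k then (if q + 1 = n i then 0 else q + 1)
  else q

/-- A configuration records, for every automaton, the set of its currently active states. -/
abbrev Config := ℕ → Finset ℕ

/-- Reading the letter `j`; an active final state of one automaton activates the start state
of the next one. -/
def step (k : ℕ) (n : ℕ → ℕ) (j : ℕ) (c : Config) : Config
  | 0 => (c 0).image (trans k n 0 j)
  | i + 1 => (c (i + 1)).image (trans k n (i + 1) j) ∪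
      (if n i - 1 ∈ step k n j c i then {0} else ∅)

/-- Only the start state of the first automaton is active. -/
def initial : Config
  | 0 => {0}
  | _ + 1 => ∅

/-- Reading a word. -/
def run (k : ℕ) (n : ℕ → ℕ) (w : List (Fin k)) (c : Config) : Config :=
  w.foldl (fun c (a : Fin k) => step k n a c) c

/-- The language of the `i`-th automaton. -/
def lang (k : ℕ) (n : ℕ → ℕ) (i : ℕ) : Language (Fin k) :=
  {w | w.foldl (fun q (a : Fin k) => trans k n i a q) 0 = n i - 1}

section Semantics

variable {k : ℕ} {n : ℕ → ℕ}

theorem trans_lt {i j q : ℕ} (hn : 2 ≤ n i) (hq : q < n i) : trans k n i j q < n i := by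
  unfold trans
  split_ifs <;> omega

theorem mem_step_zero {j : ℕ} {c : Config} {q : ℕ} :
    q ∈ step k n j c 0 ↔ ∃ p ∈ c 0, trans k n 0 j p = q := by
  simp [step]

theorem mem_step_succ {i j : ℕ} {c : Config} {q : ℕ} :
    q ∈ step k n j c (i + 1) ↔
      (∃ p ∈ c (i + 1), trans k n (i + 1) j p = q) ∨ (q = 0 ∧ n i - 1 ∈ step k n j c i) := by
  rw [step]
  split_ifs with h <;> simp [h, or_comm]

theorem run_append (u v : List (Fin k)) (c : Config) :
    run k n (u ++ v) c = run k n v (run k n u c) := by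
  simp [run]

theorem run_cons (a : Fin k) (v : List (Fin k)) (c : Config) :
    run k n (a :: v) c = run k n v (step k n a c) := rfl

theorem exists_dfa (i : ℕ) (hn : 2 ≤ n i) :
    ∃ (Q : Type) (_ : Fintype Q) (D : DFA (Fin k) Q),
      D.accepts = lang k n i ∧ Fintype.card Q = n i := by
  let D : DFA (Fin k) (Fin (n i)) :=
    { step := fun q a => ⟨trans k n i a q, trans_lt hn q.2⟩
      start := ⟨0, by omega⟩
      accept := {q | q.val = n i - 1} }
  refine ⟨Fin (n i), inferInstance, D, ?_, by simp⟩
  have key : ∀ (w : List (Fin k)) (q : Fin (n i)),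
      (D.evalFrom q w).val = w.foldl (fun q (a : Fin k) => trans k n i a q) q.val := by
    intro w
    induction w with
    | nil => intro q; rfl
    | cons a w ih => intro q; exact ih (D.step q a)
  ext w
  change (D.evalFrom D.start w).val = n i - 1 ↔ _
  rw [key]
  rfl

/-- The state `q` is active in the `i`-th automaton iff it is reached along a suffix whose
complementary prefix lies in the product of the preceding languages. -/
theorem mem_run_initial (hn : ∀ i, 2 ≤ n i) (i : ℕ) (w : List (Fin k)) (q : ℕ) :
    q ∈ run k n w initial i ↔
      ∃ u v, w = u ++ v ∧ u ∈ ((List.range i).map (lang k n)).prod ∧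
        v.foldl (fun q (a : Fin k) => trans k n i a q) 0 = q := by
  induction i generalizing w q with
  | zero =>
    induction w using List.reverseRecOn generalizing q with
    | nil =>
      simp only [run, List.foldl_nil, initial, Finset.mem_singleton]
      constructor
      · rintro rfl
        exact ⟨[], [], rfl, by simp, rfl⟩
      · rintro ⟨u, v, h, -, rfl⟩
        obtain ⟨rfl, rfl⟩ := List.append_eq_nil_iff.mp h.symm
        rfl
    | append_singleton w a ih =>
      rw [run_append, run_cons]
      change q ∈ step k n a _ 0 ↔ _
      rw [mem_step_zero]
      constructor
      · rintro ⟨p, hp, rfl⟩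
        obtain ⟨u, v, rfl, hu, rfl⟩ := (ih p).1 hp
        exact ⟨u, v ++ [a], by simp, hu, by simp⟩
      · rintro ⟨u, v, h, hu, rfl⟩
        have : u = [] := by simpa using hu
        subst this
        rw [List.nil_append] at h
        subst h
        exact ⟨_, (ih _).2 ⟨[], w, rfl, hu, rfl⟩, by simp⟩
  | succ i IH =>
    have hP : ∀ w : List (Fin k), w ∈ ((List.range (i + 1)).map (lang k n)).prod ↔
        n i - 1 ∈ run k n w initial i := by
      intro w
      rw [IH, List.range_succ, List.map_append, List.prod_append]
      simp only [List.map_cons, List.map_nil, List.prod_singleton, Language.mem_mul]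
      constructor
      · rintro ⟨u, hu, v, hv, rfl⟩
        exact ⟨u, v, rfl, hu, hv⟩
      · rintro ⟨u, v, rfl, hu, hv⟩
        exact ⟨u, hu, v, hv, rfl⟩
    simp only [hP]
    induction w using List.reverseRecOn generalizing q with
    | nil =>
      simp only [run, List.foldl_nil]
      constructor
      · intro h
        simp [initial] at h
      · rintro ⟨u, v, h, hu, rfl⟩
        obtain ⟨rfl, rfl⟩ := List.append_eq_nil_iff.mp h.symm
        have := hn i
        cases i with
        | zero => simp [initial] at hu; omega
        | succ i => simp [initial] at hu
    | append_singleton w a ih =>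
      have hr : run k n (w ++ [a]) initial = step k n a (run k n w initial) := by
        rw [run_append]; rfl
      rw [hr, mem_step_succ, ← hr]
      constructor
      · rintro (⟨p, hp, rfl⟩ | ⟨rfl, h⟩)
        · obtain ⟨u, v, rfl, hu, rfl⟩ := (ih p).1 hp
          exact ⟨u, v ++ [a], by simp, hu, by simp⟩
        · exact ⟨w ++ [a], [], by simp, h, rfl⟩
      · rintro ⟨u, v, h, hu, rfl⟩
        rcases List.eq_nil_or_concat v with rfl | ⟨v, b, rfl⟩
        · right
          rw [List.append_nil] at h
          subst h
          exact ⟨rfl, hu⟩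
        · left
          rw [List.concat_eq_append, ← List.append_assoc] at h
          obtain ⟨rfl, hb⟩ := List.append_inj' h rfl
          obtain rfl : a = b := by simpa using hb
          exact ⟨_, (ih _).2 ⟨u, v, rfl, hu, rfl⟩, by simp⟩

/-- Membership in the concatenation is decided by the last component of the configuration. -/
theorem mem_prod_iff (hn : ∀ i, 2 ≤ n i) (hk : 1 ≤ k) (w : List (Fin k)) :
    w ∈ (List.ofFn fun i : Fin k => lang k n i).prod ↔
      n (k - 1) - 1 ∈ run k n w initial (k - 1) := by
  obtain ⟨m, rfl⟩ : ∃ m, k = m + 1 := ⟨k - 1, by omega⟩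
  have : (List.ofFn fun i : Fin (m + 1) => lang (m + 1) n i) =
      (List.range (m + 1)).map (lang (m + 1) n) := by
    apply List.ext_getElem
    · simp
    · intro i h₁ h₂
      rw [List.getElem_ofFn, List.getElem_map, List.getElem_range]
  rw [this, mem_run_initial hn, List.range_succ, List.map_append, List.prod_append]
  simp only [List.map_cons, List.map_nil, List.prod_singleton, Language.mem_mul,
    Nat.add_sub_cancel]
  constructor
  · rintro ⟨u, hu, v, hv, rfl⟩
    exact ⟨u, v, rfl, hu, hv⟩
  · rintro ⟨u, v, rfl, hu, hv⟩
    exact ⟨u, hu, v, hv, rfl⟩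

end Semantics

section Separation

variable {k : ℕ} {n : ℕ → ℕ}

/-- Some word is accepted from `c` but not from `d`. -/
def Separated (k : ℕ) (n : ℕ → ℕ) (c d : Config) : Prop :=
  ∃ w : List (Fin k), n (k - 1) - 1 ∈ run k n w c (k - 1) ∧
    n (k - 1) - 1 ∉ run k n w d (k - 1)

/-- All active states are states. -/
def Bounded (n : ℕ → ℕ) (c : Config) : Prop := ∀ i, ∀ q ∈ c i, q < n i

theorem Separated.of_step {c d : Config} (j : ℕ) (hj : j < k)
    (h : Separated k n (step k n j c) (step k n j d)) : Separated k n c d := by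
  obtain ⟨w, h₁, h₂⟩ := h
  exact ⟨⟨j, hj⟩ :: w, h₁, h₂⟩

theorem Bounded.step (hn : ∀ i, 2 ≤ n i) {c : Config} (hc : Bounded n c) (j : ℕ) :
    Bounded n (step k n j c) := by
  intro i q hq
  cases i with
  | zero =>
    obtain ⟨p, hp, rfl⟩ := mem_step_zero.1 hq
    exact trans_lt (hn 0) (hc 0 p hp)
  | succ i =>
    rcases mem_step_succ.1 hq with ⟨p, hp, rfl⟩ | ⟨rfl, -⟩
    · exact trans_lt (hn _) (hc _ p hp)
    · have := hn (i + 1)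
      omega

theorem trans_mem_step {i j : ℕ} {c : Config} {p : ℕ} (hp : p ∈ c i) :
    trans k n i j p ∈ step k n j c i := by
  cases i with
  | zero => exact mem_step_zero.2 ⟨p, hp, rfl⟩
  | succ i => exact mem_step_succ.2 (Or.inl ⟨p, hp, rfl⟩)

theorem mem_step_of_ne {i j : ℕ} {c : Config} {q : ℕ} (hq : q ≠ 0) (h : q ∈ step k n j c i) :
    ∃ p ∈ c i, trans k n i j p = q := by
  cases i with
  | zero => exact mem_step_zero.1 h
  | succ i => exact (mem_step_succ.1 h).resolve_right fun h => hq h.1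

theorem mem_step_of_not_fed {i j : ℕ} {c : Config} {q : ℕ}
    (hf : n i - 1 ∉ step k n j c i) (h : q ∈ step k n j c (i + 1)) :
    ∃ p ∈ c (i + 1), trans k n (i + 1) j p = q :=
  (mem_step_succ.1 h).resolve_right fun h => hf h.2

/-- A state of the last automaton active in one configuration only separates. -/
theorem separated_last (hk : 3 ≤ k) (hn : ∀ i, 2 ≤ n i) (m : ℕ) {c d : Config} {q : ℕ}
    (hq : q ∈ c (k - 1)) (hqd : q ∉ d (k - 1)) (hc : Bounded n c) (hd : Bounded n d)
    (hm : q + m = n (k - 1) - 1) : Separated k n c d := by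
  induction m generalizing c d q with
  | zero =>
    obtain rfl : q = n (k - 1) - 1 := by omega
    exact ⟨[], hq, hqd⟩
  | succ m ih =>
    have htr : ∀ p, trans k n (k - 1) (k - 2) p = if p + 1 = n (k - 1) then 0 else p + 1 := by
      intro p
      unfold trans
      split_ifs <;> omega
    refine Separated.of_step (k - 2) (by omega) (ih (q := q + 1) ?_ ?_ (hc.step hn _)
      (hd.step hn _) (by omega))
    · have := trans_mem_step (k := k) (n := n) (j := k - 2) hq
      rwa [htr, if_neg (by omega)] at this
    · intro h
      obtain ⟨p, hp, h⟩ := mem_step_of_ne (by omega) h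
      rw [htr] at h
      split_ifs at h with h'
      obtain rfl : p = q := by omega
      exact hqd hp

/-- A letter that rotates automaton `i` does not make the previous automaton final. -/
theorem final_notMem_step {i j : ℕ} (hn : ∀ i, 2 ≤ n i) {d : Config} (hk : i + 2 < k)
    (hj : j = i + 1 ∨ j = i + 2)
    (h0 : n i - 1 ∉ d i ∨ (1 ≤ i ∧ j = i + 1)) : n i - 1 ∉ step k n j d i := by
  intro h
  have := hn i
  obtain ⟨p, hp, h⟩ := mem_step_of_ne (by omega) h
  unfold trans at h
  split_ifs at h <;> first | omega | (rcases h0 with h0 | h0 <;> [(subst h; exact h0 hp); omega])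

/-- Iterating the letter `t`. -/
theorem separated_of_rotate (Inv : Config → Config → Prop) {t : ℕ} (hn : ∀ i, 2 ≤ n i)
    (ht : t + 2 < k)
    (hstep : ∀ c d, Inv c d → Inv (step k n (t + 1) c) (step k n (t + 1) d))
    (hfin : ∀ c d, Inv c d → n t - 1 ∉ d t)
    (m : ℕ) (φ : ℕ → Prop) {c d : Config} (hcd : Inv c d) (hd : Bounded n d)
    (hφ : ∀ q ∈ d (t + 1), φ ((q + m) % n (t + 1)))
    (H : ∀ c' d', Inv c' d' → Bounded n d' → (∀ q ∈ d' (t + 1), φ q) → Separated k n c' d') :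
    Separated k n c d := by
  induction m generalizing c d with
  | zero =>
    refine H c d hcd hd fun q hq => ?_
    have := hφ q hq
    rwa [Nat.add_zero, Nat.mod_eq_of_lt (hd _ q hq)] at this
  | succ m ih =>
    refine Separated.of_step (t + 1) (by omega) (ih (hstep c d hcd) (hd.step hn _) ?_)
    intro q hq
    obtain ⟨p, hp, rfl⟩ := mem_step_of_not_fed
      (final_notMem_step hn ht (Or.inl rfl) (Or.inl (hfin c d hcd))) hq
    have h := hφ p hp
    have hlt := hd _ p hp
    rw [trans, if_pos rfl, if_neg (by omega)]
    split_ifs with h'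
    · rw [← h', show p + (m + 1) = 0 + m + (p + 1) by ring, Nat.add_mod_right] at h
      rwa [← h']
    · rwa [show p + 1 + m = p + (m + 1) by ring]

/-- Collapsing an intermediate automaton to its final state. -/
theorem separated_of_collapse (Inv : Config → Config → Prop) {t : ℕ} (hn : ∀ i, 2 ≤ n i)
    (ht : t + 2 < k)
    (hstep : ∀ j c d, (j = t + 1 ∨ j = t + 2) → Inv c d →
      Inv (step k n j c) (step k n j d))
    (hfin : ∀ c d, Inv c d → n t - 1 ∉ d t)
    (m : ℕ) {c d : Config} (hcd : Inv c d) (hd : Bounded n d)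
    (hm : ∀ q ∈ d (t + 1), q = n (t + 1) - 1 ∨ q < m)
    (H : ∀ c' d', Inv c' d' → Bounded n d' → (∀ q ∈ d' (t + 1), q = n (t + 1) - 1) →
      Separated k n c' d') :
    Separated k n c d := by
  induction m generalizing c d with
  | zero =>
    exact H c d hcd hd fun q hq => (hm q hq).resolve_right (by omega)
  | succ m ih =>
    refine Separated.of_step (t + 2) (by omega) ?_
    refine separated_of_rotate Inv hn ht (fun c d => hstep _ c d (Or.inl rfl)) hfin
      (n (t + 1) - 1) (fun q => q = n (t + 1) - 1 ∨ q < m)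
      (hstep _ c d (Or.inr rfl) hcd) (hd.step hn _) ?_ (fun c' d' h₁ h₂ h₃ => ih h₁ h₂ h₃)
    intro q hq
    have h2 := hn (t + 1)
    obtain ⟨p, hp, rfl⟩ := mem_step_of_not_fed
      (final_notMem_step hn ht (Or.inr rfl) (Or.inl (hfin c d hcd))) hq
    have h := hm p hp
    have hlt := hd _ p hp
    rw [trans, if_neg (by omega), if_pos rfl]
    by_cases hp0 : p = 0 ∨ p + 1 = n (t + 1)
    · left
      rw [show (if p + 1 = n (t + 1) ∧ 1 ≤ t + 1 then 0 else p) = 0 by split_ifs <;> omega,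
        Nat.zero_add, Nat.mod_eq_of_lt (by omega)]
    · right
      rw [if_neg (by omega), show p + (n (t + 1) - 1) = p - 1 + n (t + 1) by omega,
        Nat.add_mod_right, Nat.mod_eq_of_lt (by omega)]
      omega

/-- Collapsing the last automaton to its start state. -/
theorem separated_of_collapse_last (Inv : Config → Config → Prop) (hk : 3 ≤ k)
    (hn : ∀ i, 2 ≤ n i)
    (hstep : ∀ c d, Inv c d → Inv (step k n (k - 1) c) (step k n (k - 1) d))
    (m r : ℕ) (hmr : m + r = n (k - 1)) {c d : Config} (hcd : Inv c d) (hd : Bounded n d)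
    (hm : ∀ q ∈ d (k - 1), q = 0 ∨ r ≤ q)
    (H : ∀ c' d', Inv c' d' → Bounded n d' → (∀ q ∈ d' (k - 1), q = 0) →
      Separated k n c' d') :
    Separated k n c d := by
  induction m generalizing c d r with
  | zero =>
    refine H c d hcd hd fun q hq => ?_
    have := hm q hq
    have := hd _ q hq
    omega
  | succ m ih =>
    refine Separated.of_step (k - 1) (by omega)
      (ih (r + 1) (by omega) (hstep c d hcd) (hd.step hn _) ?_)
    intro q hq
    by_cases hq0 : q = 0
    · exact Or.inl hq0
    obtain ⟨p, hp, rfl⟩ := mem_step_of_ne hq0 hq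
    have := hm p hp
    right
    revert hq0
    unfold trans
    split_ifs <;> omega

/-- Rotating a state of an intermediate automaton to a prescribed position. -/
theorem separated_of_rotate_mem (hn : ∀ i, 2 ≤ n i) {i s : ℕ} (hi : 1 ≤ i) (hik : i + 1 < k)
    (m : ℕ) {c d : Config} {q : ℕ} (hq : q ∈ c i) (hqd : q ∉ d i) (hc : Bounded n c)
    (hd : Bounded n d) (h0 : i = 1 → n 0 - 1 ∉ d 0) (hm : (q + m) % n i = s)
    (H : ∀ c' d', s ∈ c' i → s ∉ d' i → Bounded n c' → Bounded n d' →
      Separated k n c' d') : Separated k n c d := by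
  induction m generalizing c d q with
  | zero =>
    rw [Nat.add_zero, Nat.mod_eq_of_lt (hc _ q hq)] at hm
    subst hm
    exact H c d hq hqd hc hd
  | succ m ih =>
    have hlt := hc _ q hq
    have htr : ∀ p, trans k n i i p = if p + 1 = n i then 0 else p + 1 := by
      intro p
      rw [trans, if_pos rfl, if_neg (by omega)]
    refine Separated.of_step i (by omega) (ih (q := trans k n i i q) (trans_mem_step hq) ?_
      (hc.step hn _) (hd.step hn _) ?_ ?_)
    · intro h
      obtain ⟨i, rfl⟩ : ∃ i', i = i' + 1 := ⟨i - 1, by omega⟩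
      obtain ⟨p, hp, h⟩ := mem_step_of_not_fed (final_notMem_step hn (by omega) (Or.inl rfl) (by
        by_cases hi0 : i = 0
        · subst hi0
          exact Or.inl (h0 rfl)
        · exact Or.inr ⟨by omega, rfl⟩)) h
      have hpd := hd _ p hp
      rw [htr, htr] at h
      have : p = q := by split_ifs at h <;> omega
      subst this
      exact hqd hp
    · rintro rfl h
      obtain ⟨p, hp, h⟩ := mem_step_zero.1 h
      have : p = n 0 - 1 := by
        unfold trans at h
        split_ifs at h <;> first | contradiction | omega
      subst this
      exact h0 rfl hp
    · rw [htr]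
      split_ifs with h
      · rw [← hm, show q + (m + 1) = 0 + m + (q + 1) by ring, h, Nat.add_mod_right]
      · rwa [show q + 1 + m = q + (m + 1) by ring]

theorem separated_of_mem (hk : 3 ≤ k) (hn : ∀ i, 2 ≤ n i)
    (hmid : ∀ i, 1 ≤ i → i + 1 < k → 3 ≤ n i) (m : ℕ) {i : ℕ} (him : i + m + 1 = k)
    (hi : 1 ≤ i) {c d : Config} {q : ℕ} (hq : q ∈ c i) (hqd : q ∉ d i) (hc : Bounded n c)
    (hd : Bounded n d) (h0 : i = 1 → n 0 - 1 ∉ d 0) : Separated k n c d := by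
  induction m generalizing i c d q with
  | zero =>
    obtain rfl : i = k - 1 := by omega
    have := hc _ q hq
    exact separated_last hk hn (n (k - 1) - 1 - q) hq hqd hc hd (by omega)
  | succ m ih =>
    have h3 := hmid i hi (by omega)
    have h2 := hn (i + 1)
    have hlt := hc _ q hq
    refine separated_of_rotate_mem (s := n i - 2) hn hi (by omega) (n i - q + (n i - 2)) hq hqd
      hc hd h0 ?_ ?_
    · rw [show q + (n i - q + (n i - 2)) = n i - 2 + n i by omega, Nat.add_mod_right,
        Nat.mod_eq_of_lt (by omega)]
    clear! c d q
    intro c d hq hqd hc hd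
    -- one letter `i + 1` removes the final state
    refine Separated.of_step (i + 1) (by omega) ?_
    let Inv : Config → Config → Prop := fun c d =>
      n i - 2 ∈ c i ∧ n i - 2 ∉ d i ∧ n i - 1 ∉ d i ∧ Bounded n c
    have htr : ∀ p, trans k n i (i + 1) p = if p + 1 = n i then 0 else p := by
      intro p
      rw [trans, if_neg (by omega), if_pos rfl]
      simp only [hi, and_true]
    have hstep₁ : ∀ c d, n i - 2 ∈ c i → n i - 2 ∉ d i → Bounded n c →
        Inv (step k n (i + 1) c) (step k n (i + 1) d) := by
      intro c d hq hqd hc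
      refine ⟨?_, ?_, ?_, hc.step hn _⟩
      · have := trans_mem_step (k := k) (n := n) (j := i + 1) hq
        rwa [htr, if_neg (by omega)] at this
      · intro h
        obtain ⟨p, hp, h⟩ := mem_step_of_ne (by omega) h
        rw [htr] at h
        split_ifs at h
        · omega
        · subst h
          exact hqd hp
      · intro h
        obtain ⟨p, hp, h⟩ := mem_step_of_ne (by omega) h
        rw [htr] at h
        split_ifs at h <;> omega
    have hstep₂ : ∀ c d, Inv c d → Inv (step k n (i + 2) c) (step k n (i + 2) d) := by
      rintro c d ⟨hq, hqd, hfd, hc⟩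
      have htr' : ∀ p, trans k n i (i + 2) p = p := by
        intro p
        unfold trans
        split_ifs <;> omega
      refine ⟨?_, ?_, ?_, hc.step hn _⟩
      · have := trans_mem_step (k := k) (n := n) (j := i + 2) hq
        rwa [htr'] at this
      · intro h
        obtain ⟨p, hp, h⟩ := mem_step_of_ne (by omega) h
        rw [htr'] at h
        exact hqd (h ▸ hp)
      · intro h
        obtain ⟨p, hp, h⟩ := mem_step_of_ne (by omega) h
        rw [htr'] at h
        exact hfd (h ▸ hp)
    have hfinal : ∀ c d, Inv c d → Bounded n d →
        (∀ q ∈ d (i + 1), trans k n (i + 1) i q ≠ 0) → Separated k n c d := by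
      rintro c d ⟨hq, hqd, hfd, hc⟩ hd hd1
      have htr' : ∀ p, trans k n i i p = if p + 1 = n i then 0 else p + 1 := by
        intro p
        rw [trans, if_pos rfl, if_neg (by omega)]
      refine Separated.of_step i (by omega) (ih (i := i + 1) (q := 0) (by omega) (by omega) ?_ ?_
        (hc.step hn _) (hd.step hn _) (by omega))
      · refine mem_step_succ.2 (Or.inr ⟨rfl, ?_⟩)
        have := trans_mem_step (k := k) (n := n) (j := i) hq
        rwa [htr', if_neg (by omega), show n i - 2 + 1 = n i - 1 by omega] at this
      · intro h
        rcases mem_step_succ.1 h with ⟨p, hp, h⟩ | ⟨-, h⟩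
        · exact hd1 p hp h
        · obtain ⟨p, hp, h⟩ := mem_step_of_ne (by omega) h
          rw [htr'] at h
          split_ifs at h
          · omega
          · obtain rfl : p = n i - 2 := by omega
            exact hqd hp
    have hinv := hstep₁ c d hq hqd hc
    by_cases hik : i + 2 = k
    · have hi1 : i + 1 = k - 1 := by omega
      refine separated_of_collapse_last Inv hk hn ?_ (n (k - 1)) 0 (by omega) hinv
        (hd.step hn _) (fun q _ => Or.inr (Nat.zero_le q)) ?_
      · rintro c d ⟨hq, hqd, hfd, hc⟩
        rw [← hi1]
        exact hstep₁ c d hq hqd hc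
      · intro c d hcd hd h
        refine hfinal c d hcd hd fun q hq => ?_
        rw [hi1] at hq
        rw [h q hq]
        unfold trans
        split_ifs <;> omega
    · refine separated_of_collapse Inv hn (by omega) ?_ (fun c d h => h.2.2.1) (n (i + 1)) hinv
        (hd.step hn _) (fun q hq => Or.inr ((hd.step hn _) _ q hq)) ?_
      · rintro j c d (rfl | rfl) hcd
        · exact hstep₁ c d hcd.1 hcd.2.1 hcd.2.2.2
        · exact hstep₂ c d hcd
      · intro c d hcd hd h
        refine hfinal c d hcd hd fun q hq => ?_
        rw [h q hq]
        unfold trans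
        split_ifs <;> omega

/-- Configurations whose first components differ are separated. -/
theorem separated_of_first_ne (hk : 3 ≤ k) (hn : ∀ i, 2 ≤ n i)
    (hmid : ∀ i, 1 ≤ i → i + 1 < k → 3 ≤ n i) (m : ℕ) {c d : Config} {q : ℕ}
    (hq : q ∈ c 0) (hqd : q ∉ d 0) (hc : Bounded n c) (hd : Bounded n d)
    (hm : q + m = n 0 - 1) : Separated k n c d := by
  induction m generalizing c d q with
  | zero =>
    obtain rfl : q = n 0 - 1 := by omega
    let Inv : Config → Config → Prop := fun c d =>
      n 0 - 1 ∈ c 0 ∧ n 0 - 1 ∉ d 0 ∧ 0 ∈ c 1 ∧ Bounded n c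
    have hstep : ∀ j c d, (j = 1 ∨ j = 2) → n 0 - 1 ∈ c 0 → n 0 - 1 ∉ d 0 → Bounded n c →
        Inv (step k n j c) (step k n j d) := by
      intro j c d hj hq hqd hc
      have htr : ∀ p, trans k n 0 j p = p := by
        intro p
        unfold trans
        split_ifs <;> omega
      have h1 : n 0 - 1 ∈ step k n j c 0 := by
        have := trans_mem_step (k := k) (n := n) (j := j) hq
        rwa [htr] at this
      refine ⟨h1, ?_, mem_step_succ.2 (Or.inr ⟨rfl, h1⟩), hc.step hn _⟩
      intro h
      obtain ⟨p, hp, h⟩ := mem_step_zero.1 h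
      rw [htr] at h
      exact hqd (h ▸ hp)
    have h3 := hmid 1 le_rfl (by omega)
    refine Separated.of_step 1 (by omega) (separated_of_collapse (t := 0) Inv hn (by omega) ?_
      (fun c d h => h.2.1) (n 1) (hstep 1 c d (Or.inl rfl) hq hqd hc) (hd.step hn _)
      (fun q hq => Or.inr ((hd.step hn _) _ q hq)) ?_)
    · rintro j c d hj hcd
      exact hstep j c d hj hcd.1 hcd.2.1 hcd.2.2.2
    · intro c d hcd hd h
      refine separated_of_mem hk hn hmid (k - 2) (i := 1) (q := 0) (by omega) le_rfl hcd.2.2.1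
        (fun h' => ?_) hcd.2.2.2 hd (fun _ => hcd.2.1)
      have := h 0 h'
      rw [zero_add] at this
      omega
  | succ m ih =>
    have htr : ∀ p, trans k n 0 0 p = if p + 1 = n 0 then 0 else p + 1 := by
      intro p
      rw [trans, if_pos rfl, if_neg (by omega)]
    refine Separated.of_step 0 (by omega) (ih (q := q + 1) ?_ ?_ (hc.step hn _)
      (hd.step hn _) (by omega))
    · have := trans_mem_step (k := k) (n := n) (j := 0) hq
      rwa [htr, if_neg (by omega)] at this
    · intro h
      obtain ⟨p, hp, h⟩ := mem_step_zero.1 h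
      rw [htr] at h
      split_ifs at h
      obtain rfl : p = q := by omega
      exact hqd hp

/-- Configurations with the same single active state in the first automaton are separated as
soon as some component is not contained in the other. -/
theorem separated_of_first_eq (hk : 3 ≤ k) (hn : ∀ i, 2 ≤ n i)
    (hmid : ∀ i, 1 ≤ i → i + 1 < k → 3 ≤ n i) {c d : Config} {p i q : ℕ} (hd0 : d 0 = {p})
    (hi : 1 ≤ i) (hik : i < k) (hq : q ∈ c i) (hqd : q ∉ d i) (hc : Bounded n c)
    (hd : Bounded n d) : Separated k n c d := by
  by_cases hp : p = n 0 - 1 ∧ i = 1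
  · obtain ⟨rfl, rfl⟩ := hp
    have h2 := hn 0
    have hf : n 0 - 1 ∉ step k n 0 d 0 := by
      intro h
      obtain ⟨p, hp, h⟩ := mem_step_zero.1 h
      rw [hd0, Finset.mem_singleton] at hp
      subst hp
      unfold trans at h
      split_ifs at h <;> omega
    have htr : ∀ p, trans k n 1 0 p = p := by
      intro p
      unfold trans
      split_ifs <;> first | contradiction | omega
    refine Separated.of_step 0 (by omega) (separated_of_mem hk hn hmid (k - 2) (i := 1) (q := q)
      (by omega) le_rfl ?_ ?_ (hc.step hn _) (hd.step hn _) (fun _ => hf))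
    · have := trans_mem_step (k := k) (n := n) (j := 0) hq
      rwa [htr] at this
    · intro h
      obtain ⟨p, hp, h⟩ := mem_step_of_not_fed hf h
      rw [htr] at h
      exact hqd (h ▸ hp)
  · refine separated_of_mem hk hn hmid (k - 1 - i) (by omega) hi hq hqd hc hd ?_
    rintro rfl h
    rw [hd0, Finset.mem_singleton] at h
    omega

end Separation

section Reachability

variable {k : ℕ} {n : ℕ → ℕ}

/-- The configuration is reached from the initial one (on the `k` relevant components). -/
def Reachable (k : ℕ) (n : ℕ → ℕ) (c : Config) : Prop :=
  ∃ w : List (Fin k), ∀ i < k, run k n w initial i = c i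

/-- An active final state forces the next start state to be active. -/
def Fed (k : ℕ) (n : ℕ → ℕ) (c : Config) : Prop :=
  ∀ i, i + 1 < k → n i - 1 ∈ c i → 0 ∈ c (i + 1)

/-- Components after an empty component are empty. -/
def EmptyChain (c : Config) : Prop := ∀ i, 1 ≤ i → c i = ∅ → c (i + 1) = ∅

theorem step_congr {c d : Config} {j : ℕ} (h : ∀ i < k, c i = d i) :
    ∀ i < k, step k n j c i = step k n j d i := by
  intro i hi
  induction i with
  | zero => rw [step, step, h 0 hi]
  | succ i ih => rw [step, step, h _ hi, ih (by omega)]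

theorem run_congr (w : List (Fin k)) {c d : Config} (h : ∀ i < k, c i = d i) :
    ∀ i < k, run k n w c i = run k n w d i := by
  induction w generalizing c d with
  | nil => exact h
  | cons a w ih => exact ih (step_congr h)

theorem Reachable.congr {c d : Config} (hc : Reachable k n c) (h : ∀ i < k, c i = d i) :
    Reachable k n d := by
  obtain ⟨w, hw⟩ := hc
  exact ⟨w, fun i hi => (hw i hi).trans (h i hi)⟩

theorem Reachable.step {c d : Config} (hc : Reachable k n c) {j : ℕ} (hj : j < k)
    (hd : Fed k n d)
    (h : ∀ i < k, d i = (c i).image (trans k n i j) ∨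
      (1 ≤ i ∧ n (i - 1) - 1 ∈ d (i - 1) ∧ d i = insert 0 ((c i).image (trans k n i j)))) :
    Reachable k n d := by
  obtain ⟨w, hw⟩ := hc
  refine ⟨w ++ [⟨j, hj⟩], fun i hi => ?_⟩
  rw [run_append, run_cons]
  change ConcatWitness.step k n j _ i = d i
  rw [step_congr hw i hi]
  induction i with
  | zero =>
    rcases h 0 hi with h | h
    · rw [ConcatWitness.step, h]
    · omega
  | succ i ih =>
    rw [ConcatWitness.step, ih (by omega)]
    rcases h (i + 1) hi with h | ⟨-, h1, h2⟩
    · split_ifs with hf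
      · have h0 := hd i hi hf
        rw [h] at h0 ⊢
        rw [Finset.union_eq_left]
        simpa using h0
      · rw [h, Finset.union_empty]
    · rw [Nat.add_sub_cancel] at h1
      rw [if_pos h1, h2, Finset.insert_eq, Finset.union_comm]

theorem image_eq_self {s : Finset ℕ} {f : ℕ → ℕ} (h : ∀ q ∈ s, f q = q) : s.image f = s := by
  conv_rhs => rw [← Finset.image_id (s := s)]
  exact Finset.image_congr fun q hq => h q hq

theorem Reachable.insert_zero {i : ℕ} (hn : ∀ i, 2 ≤ n i) (hi : i + 2 < k) {c : Config}
    (hz : ∀ l ≤ i, c l = {0}) (hf : Fed k n c) (hc : Reachable k n c) :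
    Reachable k n (Function.update c (i + 1) (insert 0 (c (i + 1)))) := by
  let d : ℕ → Config := fun m l =>
    if l = i then {m} else if l = i + 1 ∧ m = n i - 1 then insert 0 (c (i + 1)) else c l
  have hid : ∀ l, l ≠ i → (c l).image (trans k n l i) = c l := by
    intro l hl
    refine image_eq_self fun q hq => ?_
    have : l + 1 = i → q = 0 := by
      intro hl
      rw [hz l (by omega), Finset.mem_singleton] at hq
      exact hq
    unfold trans
    split_ifs <;> omega
  have hins : ∀ l (s : Finset ℕ), n l - 1 ∈ insert 0 s → n l - 1 ∈ s := by
    intro l s h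
    have := hn l
    exact (Finset.mem_insert.1 h).resolve_left (by omega)
  have hdf : ∀ m, Fed k n (d m) := by
    intro m l hl h
    simp only [d] at h ⊢
    by_cases h1 : l = i
    · subst h1
      rw [if_pos rfl, Finset.mem_singleton] at h
      simp [h]
    rw [if_neg h1] at h
    by_cases h2 : l + 1 = i
    · simp only [show l ≠ i + 1 by omega, false_and, if_false] at h
      have := hn l
      rw [hz l (by omega), Finset.mem_singleton] at h
      omega
    simp only [h2, if_false, show l + 1 ≠ i + 1 by omega, false_and]
    refine hf l hl ?_
    split_ifs at h with h3
    · rw [h3.1] at h ⊢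
      exact hins _ _ h
    · exact h
  have h2 := hn i
  have hreach : ∀ m, m ≤ n i - 1 → Reachable k n (d m) := by
    intro m
    induction m with
    | zero =>
      intro _
      refine hc.congr fun l _ => ?_
      simp only [d, show 0 ≠ n i - 1 by omega, and_false, if_false]
      split_ifs with h
      · exact h ▸ hz i le_rfl
      · rfl
    | succ m ih =>
      intro hm
      refine (ih (by omega)).step (j := i) (by omega) (hdf _) fun l _ => ?_
      simp only [d, show m ≠ n i - 1 by omega, and_false, if_false]
      by_cases h1 : l = i
      · subst h1
        left
        simp only [if_true, Finset.image_singleton]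
        rw [trans, if_pos rfl, if_neg (by omega), if_neg (by omega)]
      simp only [h1, if_false, hid l h1]
      by_cases h3 : l = i + 1 ∧ m + 1 = n i - 1
      · right
        rw [if_pos h3]
        obtain ⟨rfl, h3⟩ := h3
        refine ⟨by omega, ?_, rfl⟩
        simp [h3]
      · exact Or.inl (if_neg h3)
  refine (hreach _ le_rfl).step (j := i) (by omega) ?_ fun l _ => ?_
  · intro l hl h
    by_cases h1 : l = i
    · subst h1
      simp
    have h' : n l - 1 ∈ c l := by
      by_cases h2 : l = i + 1
      · rw [h2, Function.update_self] at h
        rw [h2]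
        exact hins _ _ h
      · rwa [Function.update_of_ne h2] at h
    rw [Function.update_of_ne (by omega)]
    exact hf l hl h'
  · left
    by_cases h1 : l = i
    · subst h1
      rw [Function.update_of_ne (by omega), hz l le_rfl]
      simp only [d, if_true, Finset.image_singleton]
      rw [trans, if_pos rfl, if_neg (by omega), if_pos (by omega)]
    by_cases h3 : l = i + 1
    · subst h3
      simp only [d, Function.update_self, h1, if_false, and_self, if_true, Finset.image_insert]
      rw [hid _ h1]
      congr 1
      unfold trans
      split_ifs <;> omega
    · rw [Function.update_of_ne h3]
      simp only [d, h1, h3, false_and, if_false]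
      exact (hid l h1).symm

theorem reachable_initial_segment (hn : ∀ i, 2 ≤ n i) (i : ℕ) (hi : i + 1 < k) :
    Reachable k n (fun l => if l ≤ i then {0} else ∅) := by
  induction i with
  | zero =>
    refine ⟨[], fun l _ => ?_⟩
    cases l <;> simp [run, initial]
  | succ i ih =>
    refine ((ih (by omega)).insert_zero (i := i) hn hi (fun l hl => if_pos hl) ?_).congr ?_
    · intro l _ h
      have := hn l
      beta_reduce at h ⊢
      split_ifs at h
      · rw [Finset.mem_singleton] at h
        omega
      · simp at h
    · intro l _
      by_cases h1 : l = i + 1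
      · subst h1
        simp
      · rw [Function.update_of_ne h1]
        by_cases h2 : l ≤ i
        · rw [if_pos h2, if_pos (by omega)]
        · rw [if_neg h2, if_neg (by omega)]

/-- Forward rotation of `0, …, N - 1`. -/
def rot (N q : ℕ) : ℕ := if q + 1 = N then 0 else q + 1

/-- Backward rotation of `0, …, N - 1`. -/
def unrot (N q : ℕ) : ℕ := if q = 0 then N - 1 else q - 1

theorem unrot_lt {N q : ℕ} (h : q < N) : unrot N q < N := by
  unfold unrot
  split_ifs <;> omega

theorem rot_unrot {N q : ℕ} (h : q < N) : rot N (unrot N q) = q := by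
  unfold rot unrot
  split_ifs <;> omega

theorem image_rot_unrot {N : ℕ} {s : Finset ℕ} (h : ∀ q ∈ s, q < N) :
    (s.image (unrot N)).image (rot N) = s := by
  rw [Finset.image_image]
  exact image_eq_self fun q hq => rot_unrot (h q hq)

theorem image_unrot_lt {N : ℕ} {s : Finset ℕ} (h : ∀ q ∈ s, q < N) :
    ∀ q ∈ s.image (unrot N), q < N := by
  intro q hq
  obtain ⟨p, hp, rfl⟩ := Finset.mem_image.1 hq
  exact unrot_lt (h p hp)

theorem image_iterate_unrot_lt {N : ℕ} {s : Finset ℕ} (h : ∀ q ∈ s, q < N) (r : ℕ) :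
    ∀ q ∈ s.image (unrot N)^[r], q < N := by
  induction r with
  | zero => simpa using h
  | succ r ih =>
    rw [Function.iterate_succ', ← Finset.image_image]
    exact image_unrot_lt ih

/-- Only the start state is active in every automaton except possibly the last one. -/
def lastConfig (k : ℕ) (s : Finset ℕ) : Config := fun l => if l + 1 = k then s else {0}

theorem fed_lastConfig (hn : ∀ i, 2 ≤ n i) (s : Finset ℕ) : Fed k n (lastConfig k s) := by
  intro l hl h
  have := hn l
  rw [lastConfig, if_neg (by omega), Finset.mem_singleton] at h
  omega

theorem reachable_lastConfig_rot (hk : 3 ≤ k) (hn : ∀ i, 2 ≤ n i) {s : Finset ℕ}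
    (hs : 0 ∉ s) (h : Reachable k n (lastConfig k s)) :
    Reachable k n (lastConfig k (s.image (rot (n (k - 1))))) := by
  refine h.step (j := k - 1) (by omega) (fed_lastConfig hn _) fun l hl => Or.inl ?_
  unfold lastConfig
  split_ifs with h1
  · refine Finset.image_congr fun q hq => ?_
    have hq0 : q ≠ 0 := fun h => hs (h ▸ hq)
    obtain rfl : l = k - 1 := by omega
    rw [trans, if_pos rfl, if_neg (by omega), rot]
  · rw [Finset.image_singleton]
    congr 1
    unfold trans
    split_ifs <;> omega

theorem reachable_lastConfig_insert (hk : 3 ≤ k) (hn : ∀ i, 2 ≤ n i) {s : Finset ℕ}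
    (hs : ∀ q ∈ s, q < n (k - 1))
    (h : Reachable k n (lastConfig k (s.image (unrot (n (k - 1)))^[n (k - 2)]))) :
    Reachable k n (lastConfig k (insert 1 s)) := by
  have h2 := hn (k - 2)
  have h1 := hn (k - 1)
  let d : ℕ → Config := fun m l =>
    if l + 2 = k then {m} else if l + 1 = k then
      (if m = n (k - 2) - 1 then insert 0 (s.image (unrot (n (k - 1))))
        else s.image (unrot (n (k - 1)))^[n (k - 2) - m])
    else {0}
  have hdf : ∀ m, Fed k n (d m) := by
    intro m l hl h
    simp only [d] at h ⊢
    by_cases h3 : l + 2 = k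
    · obtain rfl : l = k - 2 := by omega
      rw [if_pos h3, Finset.mem_singleton] at h
      rw [if_neg (by omega), if_pos (by omega), if_pos h.symm]
      simp
    · rw [if_neg h3, if_neg (by omega), Finset.mem_singleton] at h
      have := hn l
      omega
  have hlast : ∀ q, trans k n (k - 1) (k - 2) q = rot (n (k - 1)) q := by
    intro q
    rw [trans, if_neg (by omega), if_neg (by omega), if_pos (by omega), rot]
  have hrest : ∀ l, l + 1 < k → l + 2 ≠ k → trans k n l (k - 2) 0 = 0 := by
    intro l _ _
    unfold trans
    split_ifs <;> omega
  have himg : ∀ r, (s.image (unrot (n (k - 1)))^[r + 1]).image (rot (n (k - 1))) =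
      s.image (unrot (n (k - 1)))^[r] := by
    intro r
    rw [Function.iterate_succ', ← Finset.image_image]
    exact image_rot_unrot (image_iterate_unrot_lt hs r)
  have hreach : ∀ m, m ≤ n (k - 2) - 1 → Reachable k n (d m) := by
    intro m
    induction m with
    | zero =>
      intro _
      refine h.congr fun l _ => ?_
      simp only [d, lastConfig, show 0 ≠ n (k - 2) - 1 by omega, if_false, Nat.sub_zero]
      split_ifs <;> first | rfl | omega
    | succ m ih =>
      intro hm
      refine (ih (by omega)).step (j := k - 2) (by omega) (hdf _) fun l hl => ?_
      simp only [d, show m ≠ n (k - 2) - 1 by omega, if_false]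
      by_cases h3 : l + 2 = k
      · left
        obtain rfl : l = k - 2 := by omega
        simp only [h3, if_true, Finset.image_singleton]
        rw [trans, if_pos rfl, if_neg (by omega), if_neg (by omega)]
      by_cases h4 : l + 1 = k
      · obtain rfl : l = k - 1 := by omega
        have hi : (s.image (unrot (n (k - 1)))^[n (k - 2) - m]).image
            (trans k n (k - 1) (k - 2)) =
            s.image (unrot (n (k - 1)))^[n (k - 2) - (m + 1)] := by
          rw [Finset.image_congr fun q _ => hlast q,
            show n (k - 2) - m = n (k - 2) - (m + 1) + 1 by omega, himg]
        simp only [h3, h4, if_true, if_false, hi]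
        by_cases h5 : m + 1 = n (k - 2) - 1
        · right
          rw [if_pos h5]
          refine ⟨by omega, ?_, ?_⟩
          · rw [if_pos (by omega), Finset.mem_singleton, show k - 1 - 1 = k - 2 by omega, h5]
          · rw [show n (k - 2) - (m + 1) = 1 by omega, Function.iterate_one]
        · exact Or.inl (if_neg h5)
      · left
        simp only [h3, h4, if_false, Finset.image_singleton]
        rw [hrest l (by omega) h3]
  refine (hreach _ le_rfl).step (j := k - 2) (by omega) (fed_lastConfig hn _) fun l hl => ?_
  left
  simp only [d, lastConfig, if_true]
  by_cases h3 : l + 2 = k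
  · obtain rfl : l = k - 2 := by omega
    rw [if_neg (by omega), if_pos h3, Finset.image_singleton, trans, if_pos rfl,
      if_neg (by omega), if_pos (by omega)]
  by_cases h4 : l + 1 = k
  · obtain rfl : l = k - 1 := by omega
    rw [if_pos h4, if_neg h3, if_pos h4, Finset.image_congr fun q _ => hlast q,
      Finset.image_insert, image_rot_unrot hs]
    congr 1
    unfold rot
    split_ifs <;> omega
  · rw [if_neg h4, if_neg h3, if_neg h4, Finset.image_singleton, hrest l (by omega) h3]

theorem reachable_lastConfig (hk : 3 ≤ k) (hn : ∀ i, 2 ≤ n i) (m : ℕ) {s : Finset ℕ}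
    (hs : ∀ q ∈ s, q < n (k - 1)) (hm : s.card ≤ m) : Reachable k n (lastConfig k s) := by
  have h2 := hn (k - 1)
  have hempty : Reachable k n (lastConfig k ∅) := by
    refine (reachable_initial_segment hn (k - 2) (by omega)).congr fun l hl => ?_
    unfold lastConfig
    split_ifs <;> first | rfl | omega
  induction m generalizing s with
  | zero =>
    obtain rfl : s = ∅ := by simpa using hm
    exact hempty
  | succ m ih =>
    have key : ∀ e (s : Finset ℕ), (∀ q ∈ s, q < n (k - 1)) → s.card ≤ m + 1 →
        (1 + e) % n (k - 1) ∈ s → Reachable k n (lastConfig k s) := by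
      intro e
      induction e with
      | zero =>
        intro s hs hm h
        rw [Nat.add_zero, Nat.mod_eq_of_lt (by omega)] at h
        rw [← Finset.insert_erase h]
        have hs' : ∀ q ∈ s.erase 1, q < n (k - 1) := fun q hq => hs q (Finset.mem_of_mem_erase hq)
        refine reachable_lastConfig_insert hk hn hs' (ih (image_iterate_unrot_lt hs' _) ?_)
        refine Finset.card_image_le.trans ?_
        rw [Finset.card_erase_of_mem h]
        omega
      | succ e ihe =>
        intro s hs hm h
        by_cases h1 : 1 ∈ s
        · rw [← Finset.insert_erase h1]
          have hs' : ∀ q ∈ s.erase 1, q < n (k - 1) :=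
            fun q hq => hs q (Finset.mem_of_mem_erase hq)
          refine reachable_lastConfig_insert hk hn hs' (ih (image_iterate_unrot_lt hs' _) ?_)
          refine Finset.card_image_le.trans ?_
          rw [Finset.card_erase_of_mem h1]
          omega
        · rw [← image_rot_unrot hs]
          refine reachable_lastConfig_rot hk hn ?_ (ihe _ (image_unrot_lt hs)
            (Finset.card_image_le.trans hm) ?_)
          · intro h
            obtain ⟨p, hp, h⟩ := Finset.mem_image.1 h
            unfold unrot at h
            have : p ≠ 1 := fun h => h1 (h ▸ hp)
            split_ifs at h <;> omega
          · refine Finset.mem_image.2 ⟨_, h, ?_⟩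
            rw [← Nat.add_assoc, Nat.add_mod (1 + e) 1, Nat.mod_eq_of_lt (a := 1) (by omega)]
            have hlt : (1 + e) % n (k - 1) < n (k - 1) := Nat.mod_lt _ (by omega)
            by_cases he : (1 + e) % n (k - 1) + 1 = n (k - 1)
            · rw [he, Nat.mod_self, unrot, if_pos rfl]
              omega
            · rw [Nat.mod_eq_of_lt (by omega), unrot, if_neg (by omega)]
              omega
    rcases s.eq_empty_or_nonempty with rfl | ⟨q, hq⟩
    · exact hempty
    · refine key (q + n (k - 1) - 1) s hs hm ?_
      rw [show 1 + (q + n (k - 1) - 1) = q + n (k - 1) by omega, Nat.add_mod_right,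
        Nat.mod_eq_of_lt (hs q hq)]
      exact hq

/-- The backward shift of an intermediate component `i`, carrying along the last component if it
is rotated by the same letter. -/
def shiftBack (k : ℕ) (n : ℕ → ℕ) (i : ℕ) (c : Config) : Config := fun l =>
  if l = i then (c i).image (fun q => q - 1)
  else if l = i + 1 ∧ l + 1 = k then (c l).image (unrot (n l))
  else c l

theorem Reachable.of_shiftBack {i : ℕ} (hi1 : 1 ≤ i) (hi : i + 1 < k)
    {c : Config} (hz : ∀ l < i, c l = {0}) (hb : Bounded n c) (hf : Fed k n c) (h0 : 0 ∉ c i)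
    (h : Reachable k n (shiftBack k n i c)) : Reachable k n c := by
  refine h.step (j := i) (by omega) hf fun l hl => Or.inl ?_
  unfold shiftBack
  split_ifs with h1 h2
  · subst h1
    rw [Finset.image_image]
    refine (image_eq_self fun q hq => ?_).symm
    have hq0 : q ≠ 0 := fun h => h0 (h ▸ hq)
    have := hb _ q hq
    rw [Function.comp_apply, trans, if_pos rfl, if_neg (by omega), if_neg (by omega)]
    omega
  · rw [Finset.image_image]
    refine (image_eq_self fun q hq => ?_).symm
    have h3 := rot_unrot (hb _ q hq)
    rw [rot] at h3
    rw [Function.comp_apply, trans, if_neg (by omega), if_neg (by omega), if_pos h2]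
    exact h3
  · refine (image_eq_self fun q hq => ?_).symm
    have : l + 1 = i → q = 0 := by
      intro hl
      rw [hz l (by omega), Finset.mem_singleton] at hq
      exact hq
    unfold trans
    split_ifs <;> omega

/-- It suffices to reach configurations whose component `i` is `{0}`. -/
theorem reachable_of_reachable_singleton (hn : ∀ i, 2 ≤ n i) {i : ℕ} (hi1 : 1 ≤ i)
    (hi : i + 1 < k)
    (H : ∀ c, Bounded n c → Fed k n c → EmptyChain c → (∀ l ≤ i, c l = {0}) →
      Reachable k n c) (r : ℕ) {c : Config} (hb : Bounded n c) (hf : Fed k n c)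
    (he : EmptyChain c) (hz : ∀ l < i, c l = {0}) (hne : (c i).Nonempty)
    (hr : ∑ q ∈ c i, (q + 1) = r) : Reachable k n c := by
  induction r using Nat.strong_induction_on generalizing c with
  | _ r ihr =>
    by_cases h1 : c i = {0}
    · exact H c hb hf he fun l hl => by
        rcases hl.lt_or_eq with hl | rfl
        · exact hz l hl
        · exact h1
    by_cases h0 : 0 ∈ c i
    · obtain ⟨i, rfl⟩ : ∃ i', i = i' + 1 := ⟨i - 1, by omega⟩
      let d := Function.update c (i + 1) ((c (i + 1)).erase 0)
      have hdi : d (i + 1) = (c (i + 1)).erase 0 := Function.update_self ..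
      have hdl : ∀ l, l ≠ i + 1 → d l = c l := fun l hl => Function.update_of_ne hl ..
      have hcd : c = Function.update d (i + 1) (insert 0 (d (i + 1))) := by
        rw [hdi, Finset.insert_erase h0, Function.update_idem, Function.update_eq_self]
      have hne' : (d (i + 1)).Nonempty := by
        rw [hdi, Finset.nonempty_iff_ne_empty]
        intro h
        rcases (Finset.erase_eq_empty_iff _ _).1 h with h | h
        · exact hne.ne_empty h
        · exact h1 h
      have hsub : ∀ l, d l ⊆ c l := by
        intro l
        by_cases hl : l = i + 1
        · rw [hl, hdi]
          exact Finset.erase_subset ..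
        · rw [hdl l hl]
      have hdf : Fed k n d := by
        intro l hl h
        by_cases h' : l = i
        · subst h'
          rw [hdl l (by omega), hz l (by omega), Finset.mem_singleton] at h
          have := hn l
          omega
        · rw [hdl (l + 1) (by omega)]
          exact hf l hl (hsub l h)
      have hd : Reachable k n d := by
        refine ihr _ ?_ (fun l q hq => hb l q (hsub l hq)) hdf ?_ ?_ hne' rfl
        · rw [← hr, hdi, ← Finset.sum_erase_add _ _ h0]
          omega
        · intro l hl h
          have hl' : l ≠ i + 1 := by
            rintro rfl
            exact hne'.ne_empty h
          rw [hdl l hl'] at h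
          exact Finset.subset_empty.1 ((he l hl h) ▸ hsub (l + 1))
        · intro l hl
          rw [hdl l (by omega), hz l hl]
      rw [hcd]
      refine hd.insert_zero hn hi (fun l hl => ?_) hdf
      rw [hdl l (by omega), hz l (by omega)]
    · have hni := hn i
      have hpos : ∀ q ∈ c i, q ≠ 0 := fun q hq h => h0 (h ▸ hq)
      have hsi : shiftBack k n i c i = (c i).image (fun q => q - 1) := if_pos rfl
      have hsl : ∀ l, l ≠ i → l ≠ i + 1 → shiftBack k n i c l = c l := by
        intro l h h'
        rw [shiftBack, if_neg h, if_neg (fun h => h' h.1)]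
      have hse : ∀ l, shiftBack k n i c l = ∅ ↔ c l = ∅ := by
        intro l
        unfold shiftBack
        split_ifs with h h'
        · rw [Finset.image_eq_empty, h]
        · rw [Finset.image_eq_empty]
        · rfl
      have hs0 : ∀ l, l < i → shiftBack k n i c l = {0} := by
        intro l hl
        rw [hsl l (by omega) (by omega), hz l hl]
      refine Reachable.of_shiftBack hi1 hi hz hb hf h0 (ihr _ ?_ ?_ ?_ ?_ hs0 ?_ rfl)
      · rw [← hr, hsi, Finset.sum_image]
        · refine Finset.sum_lt_sum_of_nonempty hne fun q hq => ?_
          have := hpos q hq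
          omega
        · intro p hp q hq h
          have := hpos p hp
          have := hpos q hq
          dsimp only at h
          omega
      · intro l q hq
        unfold shiftBack at hq
        split_ifs at hq with h h'
        · obtain ⟨p, hp, rfl⟩ := Finset.mem_image.1 hq
          have := hb _ p hp
          rw [h]
          omega
        · exact image_unrot_lt (hb l) q hq
        · exact hb l q hq
      · intro l hl h
        have hnl := hn l
        by_cases h1 : l + 1 ≤ i
        · rw [hs0 l (by omega), Finset.mem_singleton] at h
          omega
        by_cases h2 : l = i
        · subst h2
          rw [hsi] at h
          obtain ⟨p, hp, h⟩ := Finset.mem_image.1 h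
          have := hb _ p hp
          have := hpos p hp
          omega
        · by_cases h3 : l = i + 1
          · subst h3
            rw [hsl _ (by omega) (by omega)]
            rw [shiftBack, if_neg (by omega), if_neg (by omega)] at h
            exact hf _ hl h
          · rw [hsl _ h2 h3] at h
            rw [hsl _ (by omega) (by omega)]
            exact hf _ hl h
      · intro l hl h
        rw [hse] at h ⊢
        exact he l hl h
      · rw [hsi]
        exact hne.image _

theorem EmptyChain.eq_empty {c : Config} (he : EmptyChain c) {i l : ℕ} (hi : 1 ≤ i)
    (h : c i = ∅) (hl : i ≤ l) : c l = ∅ := by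
  induction l, hl using Nat.le_induction with
  | base => exact h
  | succ l hl ih => exact he l (by omega) ih

theorem reachable_of_tail (hk : 3 ≤ k) (hn : ∀ i, 2 ≤ n i) (m : ℕ) {i : ℕ}
    (him : i + m + 2 = k) (hi : 1 ≤ i) {c : Config} (hb : Bounded n c) (hf : Fed k n c)
    (he : EmptyChain c) (hz : ∀ l < i, c l = {0}) (hne : (c i).Nonempty) :
    Reachable k n c := by
  induction m generalizing i c with
  | zero =>
    refine reachable_of_reachable_singleton hn hi (by omega) ?_ _ hb hf he hz hne rfl
    intro c hb hf he hz
    refine (reachable_lastConfig hk hn _ (hb (k - 1)) le_rfl).congr fun l hl => ?_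
    unfold lastConfig
    split_ifs with h
    · rw [← h, Nat.add_sub_cancel]
    · rw [hz l (by omega)]
  | succ m ih =>
    refine reachable_of_reachable_singleton hn hi (by omega) ?_ _ hb hf he hz hne rfl
    intro c hb hf he hz
    rcases (c (i + 1)).eq_empty_or_nonempty with h | h
    · refine (reachable_initial_segment hn i (by omega)).congr fun l hl => ?_
      split_ifs with h'
      · exact (hz l h').symm
      · exact (he.eq_empty (by omega) h (by omega)).symm
    · exact ih (by omega) (by omega) hb hf he (fun l hl => hz l (by omega)) h

/-- Every valid configuration is reachable. -/
theorem reachable_of_valid (hk : 3 ≤ k) (hn : ∀ i, 2 ≤ n i) {c : Config} (hb : Bounded n c)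
    (hf : Fed k n c) (he : EmptyChain c) {p : ℕ} (hp : c 0 = {p}) : Reachable k n c := by
  have hpn : p < n 0 := hb 0 p (by simp [hp])
  have hdf : ∀ m ≤ p, Fed k n (Function.update c 0 {m}) := by
    intro m hm l hl h
    rw [Function.update_of_ne (by omega)]
    refine hf l hl ?_
    by_cases h0 : l = 0
    · subst h0
      rw [Function.update_self, Finset.mem_singleton] at h
      rw [hp, Finset.mem_singleton]
      omega
    · rwa [Function.update_of_ne h0] at h
  have hzero : Reachable k n (Function.update c 0 {0}) := by
    have hcl : ∀ l, 1 ≤ l → Function.update c 0 {0} l = c l :=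
      fun l hl => Function.update_of_ne (by omega) ..
    rcases (c 1).eq_empty_or_nonempty with h | h
    · refine (reachable_initial_segment hn 0 (by omega)).congr fun l hl => ?_
      split_ifs with h'
      · obtain rfl : l = 0 := by omega
        rw [Function.update_self]
      · rw [hcl l (by omega), he.eq_empty le_rfl h (by omega)]
    · refine reachable_of_tail hk hn (k - 3) (i := 1) (by omega) le_rfl ?_ (hdf 0 (by omega)) ?_
        ?_ ?_
      · intro l q hq
        by_cases h0 : l = 0
        · subst h0
          rw [Function.update_self, Finset.mem_singleton] at hq
          omega
        · rw [hcl l (by omega)] at hq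
          exact hb l q hq
      · intro l hl h
        rw [hcl l hl] at h
        rw [hcl (l + 1) (by omega)]
        exact he l hl h
      · intro l hl
        obtain rfl : l = 0 := by omega
        rw [Function.update_self]
      · rwa [hcl 1 le_rfl]
  have hreach : ∀ m ≤ p, Reachable k n (Function.update c 0 {m}) := by
    intro m
    induction m with
    | zero => exact fun _ => hzero
    | succ m ih =>
      intro hm
      refine (ih (by omega)).step (j := 0) (by omega) (hdf _ hm) fun l hl => Or.inl ?_
      by_cases h0 : l = 0
      · subst h0
        rw [Function.update_self, Function.update_self, Finset.image_singleton, trans, if_pos rfl,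
          if_neg (by omega), if_neg (by omega)]
      · rw [Function.update_of_ne h0, Function.update_of_ne h0]
        refine (image_eq_self fun q hq => ?_).symm
        unfold trans
        split_ifs <;> first | contradiction | omega
  have := hreach p le_rfl
  rwa [← hp, Function.update_eq_self] at this

end Reachability

section Counting

/-- Valid contents of `len` consecutive components. -/
structure ValidTail (len : ℕ) (n : ℕ → ℕ) (f : Config) : Prop where
  bounded : Bounded n f
  empty : ∀ i, f i = ∅ → f (i + 1) = ∅
  fed : Fed len n f
  eq_empty : ∀ i, len ≤ i → f i = ∅

/-- Prepending a component. -/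
def consConfig (s : Finset ℕ) (f : Config) : Config
  | 0 => s
  | i + 1 => f i

theorem consConfig_injective : Function.Injective fun x : Finset ℕ × Config =>
    consConfig x.1 x.2 := by
  rintro ⟨s, f⟩ ⟨t, g⟩ h
  have h0 : s = t := congrFun h 0
  have h1 : f = g := funext fun i => congrFun h (i + 1)
  rw [h0, h1]

theorem ValidTail.cons {len : ℕ} {n : ℕ → ℕ} {s : Finset ℕ} {f : Config}
    (hf : ValidTail len (fun i => n (i + 1)) f) (hs : ∀ q ∈ s, q < n 0) (hne : s.Nonempty)
    (h0 : n 0 - 1 ∈ s → 0 < len → 0 ∈ f 0) : ValidTail (len + 1) n (consConfig s f) where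
  bounded i := by
    cases i with
    | zero => exact hs
    | succ i => exact hf.bounded i
  empty i := by
    cases i with
    | zero => exact fun h => absurd h hne.ne_empty
    | succ i => exact hf.empty i
  fed i hi h := by
    cases i with
    | zero => exact h0 h (by omega)
    | succ i => exact hf.fed i (by omega) h
  eq_empty i hi := by
    cases i with
    | zero => omega
    | succ i => exact hf.eq_empty i (by omega)

/-- Prepending a nonempty component: nonfinal components are combined with all valid tails, final
ones with those whose first component contains the start state. -/
theorem exists_cons_finset {len : ℕ} {n : ℕ → ℕ} {A B : Finset Config} {X Y : Finset (Finset ℕ)}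
    (hA : ∀ f ∈ A, ValidTail len (fun i => n (i + 1)) f)
    (hB : ∀ f ∈ B, ValidTail len (fun i => n (i + 1)) f ∧ (0 < len → 0 ∈ f 0))
    (hX : ∀ s ∈ X, s.Nonempty ∧ ∀ q ∈ s, q < n 0 - 1)
    (hY : ∀ s ∈ Y, n 0 - 1 ∈ s ∧ ∀ q ∈ s, q < n 0) :
    ∃ C : Finset Config, C.card = X.card * A.card + Y.card * B.card ∧
      ∀ f ∈ C, ValidTail (len + 1) n f ∧ (f 0 ∈ X ∨ f 0 ∈ Y) := by
  classical
  have hdisj : Disjoint (X ×ˢ A) (Y ×ˢ B) := by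
    rw [Finset.disjoint_left]
    rintro ⟨s, f⟩ h₁ h₂
    have := (hX s (Finset.mem_product.1 h₁).1).2 _ (hY s (Finset.mem_product.1 h₂).1).1
    omega
  refine ⟨(X ×ˢ A ∪ Y ×ˢ B).image fun x => consConfig x.1 x.2, ?_, ?_⟩
  · rw [Finset.card_image_of_injective _ consConfig_injective, Finset.card_union_of_disjoint hdisj,
      Finset.card_product, Finset.card_product]
  · intro g hg
    obtain ⟨⟨s, f⟩, h, rfl⟩ := Finset.mem_image.1 hg
    rcases Finset.mem_union.1 h with h | h
    · obtain ⟨hs, hf⟩ := Finset.mem_product.1 h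
      refine ⟨(hA f hf).cons (fun q hq => ?_) (hX s hs).1 fun h => ?_, Or.inl hs⟩
      · have := (hX s hs).2 q hq
        omega
      · have := (hX s hs).2 _ h
        omega
    · obtain ⟨hs, hf⟩ := Finset.mem_product.1 h
      exact ⟨(hB f hf).1.cons (hY s hs).2 ⟨_, (hY s hs).1⟩ fun _ => (hB f hf).2, Or.inr hs⟩

theorem UV_cons {m : ℕ} (hm : 2 ≤ m) (l : List ℕ) :
    UV (m :: l) = (1 + (2 ^ (m - 1) - 1) * (UV l).1 + 2 ^ (m - 1) * (UV l).2,
      2 ^ (m - 2) * ((UV l).1 + (UV l).2)) := by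
  cases l with
  | cons a l => rw [UV]; simp
  | nil =>
    obtain ⟨m, rfl⟩ : ∃ m', m = m' + 2 := ⟨m - 2, by omega⟩
    have : 1 ≤ 2 ^ (m + 1) := Nat.one_le_two_pow
    simp only [UV, Nat.add_sub_cancel, show m + 2 - 1 = m + 1 by omega, Prod.mk.injEq]
    constructor
    · rw [pow_succ 2 (m + 1)]
      omega
    · ring

theorem card_image_insert {a : ℕ} {S : Finset (Finset ℕ)} (ha : ∀ s ∈ S, a ∉ s) :
    (S.image (insert a)).card = S.card := by
  refine Finset.card_image_of_injOn fun x hx y hy h => ?_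
  rw [← Finset.erase_insert (ha x hx), ← Finset.erase_insert (ha y hy), h]

theorem notMem_of_mem_powerset {a : ℕ} {t : Finset ℕ} (ha : a ∉ t) :
    ∀ s ∈ t.powerset, a ∉ s :=
  fun _ hs h => ha (Finset.mem_powerset.1 hs h)

theorem exists_valid_finset (len : ℕ) (n : ℕ → ℕ) (hn : ∀ i, 2 ≤ n i) :
    (∃ A : Finset Config, A.card = (UV (List.ofFn fun i : Fin len => n i)).1 ∧
      ∀ f ∈ A, ValidTail len n f) ∧
    (∃ B : Finset Config, B.card = (UV (List.ofFn fun i : Fin len => n i)).2 ∧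
      ∀ f ∈ B, ValidTail len n f ∧ (0 < len → 0 ∈ f 0)) := by
  have hempty : ∀ (len : ℕ) (n : ℕ → ℕ), ValidTail len n fun _ => ∅ := fun len n =>
    { bounded := fun i q hq => by simp at hq
      empty := fun _ _ => rfl
      fed := fun i _ hq => by simp at hq
      eq_empty := fun _ _ => rfl }
  induction len generalizing n with
  | zero =>
    refine ⟨⟨{fun _ => ∅}, by simp [UV], ?_⟩, ⟨{fun _ => ∅}, by simp [UV], ?_⟩⟩
    · intro f hf
      rw [Finset.mem_singleton.1 hf]
      exact hempty 0 n
    · intro f hf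
      rw [Finset.mem_singleton.1 hf]
      exact ⟨hempty 0 n, fun h => absurd h (lt_irrefl 0)⟩
  | succ len ih =>
    obtain ⟨⟨A, hAc, hA⟩, ⟨B, hBc, hB⟩⟩ := ih (fun i => n (i + 1)) fun i => hn _
    have h2 := hn 0
    have hlist : (List.ofFn fun i : Fin (len + 1) => n i) =
        n 0 :: List.ofFn fun i : Fin len => n (i + 1) := by
      rw [List.ofFn_succ]
      rfl
    rw [hlist, UV_cons h2, ← hAc, ← hBc]
    have hr : n 0 - 1 ∉ Finset.range (n 0 - 1) := by simp
    have h0 : 0 ∉ Finset.Ico 1 (n 0 - 1) := by simp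
    constructor
    · classical
      have hX : ∀ s ∈ (Finset.range (n 0 - 1)).powerset.erase ∅,
          s.Nonempty ∧ ∀ q ∈ s, q < n 0 - 1 := by
        intro s hs
        obtain ⟨hs, hs'⟩ := Finset.mem_erase.1 hs
        exact ⟨Finset.nonempty_iff_ne_empty.2 hs,
          fun q hq => Finset.mem_range.1 (Finset.mem_powerset.1 hs' hq)⟩
      have hY : ∀ s ∈ (Finset.range (n 0 - 1)).powerset.image (insert (n 0 - 1)),
          n 0 - 1 ∈ s ∧ ∀ q ∈ s, q < n 0 := by
        intro s hs
        obtain ⟨x, hx, rfl⟩ := Finset.mem_image.1 hs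
        refine ⟨Finset.mem_insert_self .., fun q hq => ?_⟩
        rcases Finset.mem_insert.1 hq with rfl | hq
        · omega
        · have := Finset.mem_range.1 (Finset.mem_powerset.1 hx hq)
          omega
      obtain ⟨C, hCc, hC⟩ := exists_cons_finset hA hB hX hY
      refine ⟨insert (fun _ => ∅) C, ?_, ?_⟩
      · rw [Finset.card_insert_of_notMem, hCc, card_image_insert (notMem_of_mem_powerset hr),
          Finset.card_erase_of_mem (by simp), Finset.card_powerset, Finset.card_range]
        · ring
        intro h
        rcases (hC _ h).2 with h | h
        · simp at h
        · obtain ⟨x, -, hx⟩ := Finset.mem_image.1 h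
          exact Finset.insert_ne_empty _ _ hx
      · intro f hf
        rcases Finset.mem_insert.1 hf with rfl | hf
        · exact hempty _ n
        · exact (hC f hf).1
    · let X := (Finset.Ico 1 (n 0 - 1)).powerset.image (insert 0)
      have hX : ∀ s ∈ X, 0 ∈ s ∧ ∀ q ∈ s, q < n 0 - 1 := by
        intro s hs
        obtain ⟨x, hx, rfl⟩ := Finset.mem_image.1 hs
        refine ⟨Finset.mem_insert_self .., fun q hq => ?_⟩
        rcases Finset.mem_insert.1 hq with rfl | hq
        · omega
        · exact (Finset.mem_Ico.1 (Finset.mem_powerset.1 hx hq)).2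
      have hXr : ∀ s ∈ X, n 0 - 1 ∉ s := fun s hs h => lt_irrefl _ ((hX s hs).2 _ h)
      have hXc : X.card = 2 ^ (n 0 - 2) := by
        rw [card_image_insert (notMem_of_mem_powerset h0), Finset.card_powerset, Nat.card_Ico]
        rfl
      obtain ⟨C, hCc, hC⟩ := exists_cons_finset (n := n) (X := X)
        (Y := X.image (insert (n 0 - 1))) hA hB
        (fun s hs => ⟨⟨0, (hX s hs).1⟩, (hX s hs).2⟩) (fun s hs => by
          obtain ⟨x, hx, rfl⟩ := Finset.mem_image.1 hs
          refine ⟨Finset.mem_insert_self .., fun q hq => ?_⟩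
          rcases Finset.mem_insert.1 hq with rfl | hq
          · omega
          · have := (hX x hx).2 q hq
            omega)
      refine ⟨C, ?_, fun f hf => ⟨(hC f hf).1, fun _ => ?_⟩⟩
      · rw [hCc, card_image_insert hXr, hXc, mul_add]
      · rcases (hC f hf).2 with h | h
        · exact (hX _ h).1
        · obtain ⟨x, hx, hxf⟩ := Finset.mem_image.1 h
          rw [← hxf]
          exact Finset.mem_insert_of_mem (hX x hx).1

/-- There are `Bval` valid configurations. -/
theorem exists_valid_configs (len : ℕ) (n : ℕ → ℕ) (hn : ∀ i, 2 ≤ n i) :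
    ∃ C : Finset Config,
      C.card = Bval (n 0) (List.ofFn fun i : Fin len => n (i + 1)) ∧
      ∀ f ∈ C, ValidTail (len + 1) n f ∧ ∃ p, f 0 = {p} := by
  obtain ⟨⟨A, hAc, hA⟩, ⟨B, hBc, hB⟩⟩ :=
    exists_valid_finset len (fun i => n (i + 1)) fun i => hn _
  have h2 := hn 0
  obtain ⟨C, hCc, hC⟩ := exists_cons_finset (n := n)
    (X := (Finset.range (n 0 - 1)).image fun p => {p}) (Y := {{n 0 - 1}}) hA hB
    (fun s hs => by
      obtain ⟨p, hp, rfl⟩ := Finset.mem_image.1 hs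
      exact ⟨Finset.singleton_nonempty p, fun q hq => by
        rw [Finset.mem_singleton.1 hq]
        exact Finset.mem_range.1 hp⟩)
    (fun s hs => by
      rw [Finset.mem_singleton.1 hs]
      refine ⟨Finset.mem_singleton_self _, fun q hq => ?_⟩
      rw [Finset.mem_singleton.1 hq]
      omega)
  refine ⟨C, ?_, fun f hf => ⟨(hC f hf).1, ?_⟩⟩
  · rw [hCc, Finset.card_image_of_injective _ Finset.singleton_injective, Finset.card_range,
      Finset.card_singleton, one_mul, hAc, hBc]
    rfl
  · rcases (hC f hf).2 with h | h
    · obtain ⟨p, -, hp⟩ := Finset.mem_image.1 h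
      exact ⟨p, hp.symm⟩
    · exact ⟨_, Finset.mem_singleton.1 h⟩

end Counting

/-- Distinct valid configurations are separated in one direction or the other. -/
theorem separated_of_ne {k : ℕ} {n : ℕ → ℕ} (hk : 3 ≤ k) (hn : ∀ i, 2 ≤ n i)
    (hmid : ∀ i, 1 ≤ i → i + 1 < k → 3 ≤ n i) {c d : Config} {p q : ℕ}
    (hc : ValidTail k n c) (hd : ValidTail k n d) (hp : c 0 = {p}) (hq : d 0 = {q})
    (hne : c ≠ d) : Separated k n c d ∨ Separated k n d c := by
  have hpn : p < n 0 := hc.bounded 0 p (by simp [hp])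
  by_cases hpq : p = q
  · subst hpq
    obtain ⟨i, hi⟩ := Function.ne_iff.1 hne
    have hik : i < k := by
      by_contra h
      exact hi ((hc.eq_empty i (by omega)).trans (hd.eq_empty i (by omega)).symm)
    have hi1 : 1 ≤ i := by
      by_contra h
      obtain rfl : i = 0 := by omega
      exact hi (hp.trans hq.symm)
    by_cases hsub : c i ⊆ d i
    · obtain ⟨r, hr, hr'⟩ := Finset.not_subset.1 fun h => hi (hsub.antisymm h)
      exact Or.inr (separated_of_first_eq hk hn hmid hp hi1 hik hr hr' hd.bounded hc.bounded)
    · obtain ⟨r, hr, hr'⟩ := Finset.not_subset.1 hsub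
      exact Or.inl (separated_of_first_eq hk hn hmid hq hi1 hik hr hr' hc.bounded hd.bounded)
  · refine Or.inl (separated_of_first_ne hk hn hmid (n 0 - 1 - p) (q := p) ?_ ?_ hc.bounded
      hd.bounded (by omega))
    · simp [hp]
    · simpa [hq] using hpq

theorem card_le_of_accepts {k : ℕ} {n : ℕ → ℕ} (hk : 3 ≤ k) (hn : ∀ i, 2 ≤ n i)
    (hmid : ∀ i, 1 ≤ i → i + 1 < k → 3 ≤ n i) (Q : Type) [Fintype Q] (D : DFA (Fin k) Q)
    (hD : D.accepts = (List.ofFn fun i : Fin k => lang k n i).prod) :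
    Bval (n 0) (List.ofFn fun i : Fin (k - 1) => n (i + 1)) ≤ Fintype.card Q := by
  obtain ⟨C, hCc, hC⟩ := exists_valid_configs (k - 1) n hn
  rw [Nat.sub_add_cancel (by omega : 1 ≤ k)] at hC
  have hreach : ∀ c ∈ C, Reachable k n c := by
    intro c hc
    obtain ⟨hv, p, hp⟩ := hC c hc
    exact reachable_of_valid hk hn hv.bounded hv.fed (fun i _ => hv.empty i) hp
  choose! w hw using hreach
  have hacc : ∀ c ∈ C, ∀ x, D.evalFrom (D.eval (w c)) x ∈ D.accept ↔
      n (k - 1) - 1 ∈ run k n x c (k - 1) := by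
    intro c hc x
    rw [← run_congr x (hw c hc) _ (by omega), ← run_append, ← mem_prod_iff hn (by omega), ← hD,
      DFA.mem_accepts, DFA.eval, DFA.evalFrom_of_append]
  have hsep : ∀ c ∈ C, ∀ d ∈ C, D.eval (w c) = D.eval (w d) → ¬ Separated k n c d := by
    rintro c hc d hd h ⟨x, h₁, h₂⟩
    rw [← hacc c hc, h] at h₁
    rw [← hacc d hd] at h₂
    exact h₂ h₁
  rw [← hCc]
  refine Finset.card_le_card_of_injOn (fun c => D.eval (w c)) (fun _ _ => Finset.mem_univ _) ?_
  intro c hc d hd h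
  by_contra hne
  obtain ⟨hv, p, hp⟩ := hC c hc
  obtain ⟨hv', q, hq⟩ := hC d hd
  rcases separated_of_ne hk hn hmid hv hv' hp hq hne with hs | hs
  · exact hsep c hc d hd h hs
  · exact hsep d hd c hc h.symm hs

end ConcatWitness

/-- For every `k ≥ 3`, `n₁, n_k ≥ 2` and `nᵢ ≥ 3` for `2 ≤ i ≤ k−1`,
there are languages over an alphabet with exactly `k` letters, each accepted by a DFA with
`nᵢ` states, whose concatenation needs at least `B(n₁,…,n_k)` states. -/
theorem stmt11 (k : ℕ) (hk : 3 ≤ k) (n : Fin k → ℕ)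
    (h1 : 2 ≤ n ⟨0, Nat.lt_of_lt_of_le (Nat.zero_lt_succ 2) hk⟩)
    (hlast : 2 ≤ n ⟨k - 1, Nat.sub_lt (Nat.lt_of_lt_of_le (Nat.zero_lt_succ 2) hk) Nat.zero_lt_one⟩)
    (hmid : ∀ i : Fin k, 1 ≤ i.val → i.val + 1 < k → 3 ≤ n i) :
    ∃ L : Fin k → Language (Fin k),
      (∀ i, ∃ (Q : Type) (_ : Fintype Q) (D : DFA (Fin k) Q),
        D.accepts = L i ∧ Fintype.card Q = n i) ∧
      (∀ (Q : Type) (inst : Fintype Q) (D : DFA (Fin k) Q),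
        D.accepts = (List.ofFn L).prod →
        Bval (n ⟨0, Nat.lt_of_lt_of_le (Nat.zero_lt_succ 2) hk⟩) ((List.ofFn n).drop 1)
          ≤ @Fintype.card Q inst) := by
  let N : ℕ → ℕ := fun i => if h : i < k then n ⟨i, h⟩ else 2
  have hN : ∀ i : Fin k, N i = n i := fun i => dif_pos i.2
  have hmid' : ∀ i, 1 ≤ i → i + 1 < k → 3 ≤ N i := by
    intro i h₁ h₂
    rw [show N i = n ⟨i, by omega⟩ from dif_pos _]
    exact hmid _ h₁ h₂
  have hN2 : ∀ i, 2 ≤ N i := by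
    intro i
    by_cases hik : i < k
    · rw [show N i = n ⟨i, hik⟩ from dif_pos hik]
      by_cases hi0 : i = 0
      · subst hi0
        exact h1
      by_cases hil : i = k - 1
      · subst hil
        exact hlast
      · exact (Nat.le_succ 2).trans (hmid ⟨i, hik⟩ (Nat.one_le_iff_ne_zero.2 hi0) (by
          change i + 1 < k
          omega))
    · rw [show N i = 2 from dif_neg hik]
  refine ⟨fun i => ConcatWitness.lang k N i, fun i => ?_, fun Q inst D hD => ?_⟩
  · rw [← hN i]
    exact ConcatWitness.exists_dfa i.val (hN2 i)
  · have h := ConcatWitness.card_le_of_accepts hk hN2 hmid' Q D hD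
    have hlist : (List.ofFn n).drop 1 = List.ofFn fun i : Fin (k - 1) => N (i + 1) := by
      apply List.ext_getElem
      · simp
      · intro i h₁ h₂
        rw [List.getElem_drop, List.getElem_ofFn, List.getElem_ofFn, ← hN]
        simp only [Nat.add_comm]
    rw [hlist, ← hN ⟨0, _⟩]
    exact h
end

section
/- For all integers n₁, n₂, n₃ ≥ 2 and all languages L₁, L₂, L₃ over a two-letter alphabet such that each L_i is accepted by some DFA with at most n_i states, the concatenation L₁L₂L₃ is accepted by some DFA with strictly fewer than B(n₁,n₂,n₃) states, where B(n₁,n₂,n₃) = (n₁−1)·(1 + (2^{n₂−1}−1)·2^{n₃} + 2^{n₂−1}·2^{n₃−1}) + 2^{n₂−2}·(2^{n₃}+2^{n₃−1}). In other words, the tight upper bound B(n₁,n₂,n₃) for the concatenation of three regular languages cannot be met over a binary alphabet. -/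
namespace ConcatBinary

open Finset

open Classical in
/-- The states reached by `M` on the suffixes `v` of `w = u ++ v` with `u ∈ L`. -/
noncomputable def suffixStates {α σ : Type*} [Fintype σ] (M : DFA α σ) (L : Language α)
    (w : List α) : Finset σ :=
  {s | ∃ u v, u ++ v = w ∧ u ∈ L ∧ M.eval v = s}

section SuffixStates

variable {α σ : Type*} [Fintype σ] (M : DFA α σ) (L : Language α)

theorem mem_suffixStates {w : List α} {s : σ} :
    s ∈ suffixStates M L w ↔ ∃ u v, u ++ v = w ∧ u ∈ L ∧ M.eval v = s := by
  simp [suffixStates]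

open Classical in
theorem suffixStates_nil :
    suffixStates M L [] = if [] ∈ L then {M.start} else ∅ := by
  ext s
  rw [mem_suffixStates]
  split_ifs with h
  · simp only [List.append_eq_nil_iff, mem_singleton]
    constructor
    · rintro ⟨u, v, ⟨rfl, rfl⟩, -, rfl⟩
      rfl
    · rintro rfl
      exact ⟨[], [], ⟨rfl, rfl⟩, h, rfl⟩
  · simp only [List.append_eq_nil_iff, notMem_empty, iff_false]
    rintro ⟨u, v, ⟨rfl, rfl⟩, hu, -⟩
    exact h hu

open Classical in
theorem suffixStates_append_singleton (w : List α) (x : α) :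
    suffixStates M L (w ++ [x]) =
      (suffixStates M L w).image (M.step · x) ∪ if w ++ [x] ∈ L then {M.start} else ∅ := by
  ext s
  simp only [mem_union, mem_image, mem_suffixStates]
  constructor
  · rintro ⟨u, v, huv, hu, rfl⟩
    rcases List.eq_nil_or_concat v with rfl | ⟨v, y, rfl⟩
    · right
      rw [List.append_nil] at huv
      rw [if_pos (huv ▸ hu)]
      simp
    · left
      rw [List.concat_eq_append, ← List.append_assoc] at huv
      obtain ⟨rfl, h⟩ := List.append_inj' huv rfl
      cases h
      exact ⟨_, ⟨u, v, rfl, hu, rfl⟩, by simp⟩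
  · rintro (⟨_, ⟨u, v, rfl, hu, rfl⟩, rfl⟩ | h)
    · exact ⟨u, v ++ [x], by simp, hu, by simp⟩
    · split_ifs at h with hL
      · exact ⟨w ++ [x], [], by simp, hL, (mem_singleton.1 h).symm⟩
      · simp at h

theorem mem_mul_accepts_iff {w : List α} :
    w ∈ L * M.accepts ↔ ∃ s ∈ suffixStates M L w, s ∈ M.accept := by
  simp only [Language.mem_mul, mem_suffixStates]
  constructor
  · rintro ⟨u, hu, v, hv, rfl⟩
    exact ⟨_, ⟨u, v, rfl, hu, rfl⟩, hv⟩
  · rintro ⟨_, ⟨u, v, rfl, hu, rfl⟩, hv⟩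
    exact ⟨u, hu, v, hv, rfl⟩

end SuffixStates

section TripleDFA

variable {α σ₁ σ₂ σ₃ : Type*} (D₁ : DFA α σ₁) (D₂ : DFA α σ₂) (D₃ : DFA α σ₃)

open Classical in
/-- The triple with first component `q`, after adding the start states of `D₂` and `D₃` to
the other components where a word of the preceding language has just been completed. -/
noncomputable def saturate (q : σ₁) (S : Finset σ₂) (T : Finset σ₃) :
    σ₁ × Finset σ₂ × Finset σ₃ :=
  let S' := S ∪ if q ∈ D₁.accept then {D₂.start} else ∅
  (q, S', T ∪ if ∃ s ∈ S', s ∈ D₂.accept then {D₃.start} else ∅)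

open Classical in
/-- The determinization of the automaton for the concatenation of three languages. -/
noncomputable def tripleDFA : DFA α (σ₁ × Finset σ₂ × Finset σ₃) where
  start := saturate D₁ D₂ D₃ D₁.start ∅ ∅
  step c x := saturate D₁ D₂ D₃ (D₁.step c.1 x) (c.2.1.image (D₂.step · x))
    (c.2.2.image (D₃.step · x))
  accept := {c | ∃ t ∈ c.2.2, t ∈ D₃.accept}

theorem eval_tripleDFA [Fintype σ₂] [Fintype σ₃] (w : List α) :
    (tripleDFA D₁ D₂ D₃).eval w =
      (D₁.eval w, suffixStates D₂ D₁.accepts w,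
        suffixStates D₃ (D₁.accepts * D₂.accepts) w) := by
  classical
  induction w using List.reverseRecOn with
  | nil =>
    rw [suffixStates_nil, suffixStates_nil]
    simp only [mem_mul_accepts_iff, suffixStates_nil]
    simp [tripleDFA, saturate, DFA.mem_accepts]
  | append_singleton w x ih =>
    rw [DFA.eval_append_singleton, ih, suffixStates_append_singleton,
      suffixStates_append_singleton]
    simp only [mem_mul_accepts_iff, suffixStates_append_singleton]
    simp [tripleDFA, saturate, DFA.mem_accepts]

theorem accepts_tripleDFA [Fintype σ₂] [Fintype σ₃] :
    (tripleDFA D₁ D₂ D₃).accepts = D₁.accepts * D₂.accepts * D₃.accepts := by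
  ext w
  rw [mem_mul_accepts_iff, DFA.mem_accepts, eval_tripleDFA]
  rfl

theorem saturate_valid {q q' : σ₁} {S S' : Finset σ₂} {T T' : Finset σ₃}
    (hST : S' = ∅ → T' = ∅) (h : saturate D₁ D₂ D₃ q' S' T' = (q, S, T)) :
    (q ∈ D₁.accept → D₂.start ∈ S) ∧ (∀ s ∈ S, s ∈ D₂.accept → D₃.start ∈ T) ∧
      (S = ∅ → T = ∅) := by
  classical
  simp only [saturate, Prod.mk.injEq] at h
  obtain ⟨rfl, rfl, rfl⟩ := h
  refine ⟨fun hq => by simp [hq], fun s hs hs' => ?_, fun hS => ?_⟩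
  · rw [if_pos ⟨s, hs, hs'⟩]
    simp
  · rw [hS]
    simp [hST (union_eq_empty.1 hS).1]

theorem eval_tripleDFA_valid (w : List α) {q : σ₁} {S : Finset σ₂} {T : Finset σ₃}
    (h : (tripleDFA D₁ D₂ D₃).eval w = (q, S, T)) :
    (q ∈ D₁.accept → D₂.start ∈ S) ∧ (∀ s ∈ S, s ∈ D₂.accept → D₃.start ∈ T) ∧
      (S = ∅ → T = ∅) := by
  classical
  induction w using List.reverseRecOn generalizing q S T with
  | nil => exact saturate_valid D₁ D₂ D₃ (fun _ => rfl) h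
  | append_singleton w x ih =>
    obtain ⟨⟨q₀, S₀, T₀⟩, hw⟩ : ∃ c, (tripleDFA D₁ D₂ D₃).eval w = c := ⟨_, rfl⟩
    rw [DFA.eval_append_singleton, hw] at h
    refine saturate_valid D₁ D₂ D₃ (fun h0 => ?_) h
    rw [image_eq_empty] at h0 ⊢
    exact (ih hw).2.2 h0

end TripleDFA

section Reachability

variable {α σ₁ σ₂ σ₃ : Type*} {D₁ : DFA α σ₁} {D₂ : DFA α σ₂} {D₃ : DFA α σ₃}
  {f₁ : σ₁} {f₂ : σ₂}

open Classical in
theorem exists_predecessor (hF₁ : D₁.accept = {f₁}) (hF₂ : D₂.accept = {f₂})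
    (hs₁ : D₁.start ≠ f₁) {w : List α} {q : σ₁} {S : Finset σ₂} {T : Finset σ₃}
    (h : (tripleDFA D₁ D₂ D₃).eval w = (q, S, T)) (hT : T.Nonempty) :
    ∃ w' x q₀ S₀ T₀, w = w' ++ [x] ∧ (tripleDFA D₁ D₂ D₃).eval w' = (q₀, S₀, T₀) ∧
      D₁.step q₀ x = q ∧
      S = S₀.image (D₂.step · x) ∪ (if q = f₁ then {D₂.start} else ∅) ∧
      T = T₀.image (D₃.step · x) ∪ (if f₂ ∈ S then {D₃.start} else ∅) := by
  rcases List.eq_nil_or_concat w with rfl | ⟨w', x, rfl⟩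
  · simp [tripleDFA, saturate, hF₁, hs₁] at h
    simp [← h.2.2] at hT
  · rw [List.concat_eq_append] at h ⊢
    obtain ⟨⟨q₀, S₀, T₀⟩, hw⟩ : ∃ c, (tripleDFA D₁ D₂ D₃).eval w' = c := ⟨_, rfl⟩
    rw [DFA.eval_append_singleton, hw] at h
    simp only [tripleDFA, saturate, hF₁, hF₂, Set.mem_singleton_iff, exists_eq_right,
      Prod.mk.injEq] at h
    obtain ⟨rfl, rfl, rfl⟩ := h
    exact ⟨w', x, q₀, S₀, T₀, rfl, hw, rfl, rfl, rfl⟩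

theorem exists_unreachable_triple [Fintype σ₁] [Fintype σ₂] [Fintype σ₃]
    {D₁ : DFA Bool σ₁} {D₂ : DFA Bool σ₂} {D₃ : DFA Bool σ₃}
    (hF₁ : D₁.accept = {f₁}) (hF₂ : D₂.accept = {f₂})
    (hs₁ : D₁.start ≠ f₁) (hs₂ : D₂.start ≠ f₂)
    {b : Bool} (hb : ¬ Function.Surjective (D₃.step · b)) :
    ∃ q S T, (q = f₁ → D₂.start ∈ S) ∧ (f₂ ∈ S → D₃.start ∈ T) ∧ (S = ∅ → T = ∅) ∧
      ∀ w, (tripleDFA D₁ D₂ D₃).eval w ≠ (q, S, T) := by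
  classical
  by_contra! hreach
  obtain ⟨a, hab⟩ : ∃ a : Bool, ∀ x, x = a ∨ x = b := ⟨!b, by cases b <;> simp⟩
  have hne : (univ : Finset σ₃).Nonempty := ⟨D₃.start, mem_univ _⟩
  -- Without `f₂` the last letter must act surjectively on the states of `D₃`.
  have hlast : ∀ {w q S}, (tripleDFA D₁ D₂ D₃).eval w = (q, S, univ) → f₂ ∉ S →
      ∃ w' q₀ S₀, w = w' ++ [a] ∧ (tripleDFA D₁ D₂ D₃).eval w' = (q₀, S₀, univ) ∧
        D₁.step q₀ a = q ∧
        S = S₀.image (D₂.step · a) ∪ (if q = f₁ then {D₂.start} else ∅) := by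
    intro w q S h hf
    obtain ⟨w', x, q₀, S₀, T₀, hw, hw', hq, hS, hT⟩ := exists_predecessor hF₁ hF₂ hs₁ h hne
    rw [if_neg hf, union_empty] at hT
    have hT₀ : T₀ = univ := by
      rw [← card_eq_iff_eq_univ]
      refine le_antisymm (card_le_univ _) ?_
      rw [← card_univ, hT]
      exact card_image_le
    subst hT₀
    rcases hab x with rfl | rfl
    · exact ⟨w', q₀, S₀, hw, hw', hq, hS⟩
    · refine absurd (fun t => ?_) hb
      obtain ⟨t', -, ht'⟩ := mem_image.1 (hT ▸ mem_univ t)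
      exact ⟨t', ht'⟩
  have hmem : D₂.start ∈ ({f₂}ᶜ : Finset σ₂) := by simpa using hs₂
  have hcompl : ∀ q, ∃ w, (tripleDFA D₁ D₂ D₃).eval w = (q, {f₂}ᶜ, univ) := fun q =>
    hreach q _ _ (fun _ => hmem) (fun _ => mem_univ _)
      (fun h => absurd hmem (h ▸ notMem_empty _))
  have hnotMem : f₂ ∉ ({f₂}ᶜ : Finset σ₂) := by simp
  have ha₁ : Function.Injective (D₁.step · a) := by
    refine Finite.injective_iff_surjective.2 fun q => ?_
    obtain ⟨w, hw⟩ := hcompl q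
    obtain ⟨_, q₀, _, -, -, hq, -⟩ := hlast hw hnotMem
    exact ⟨q₀, hq⟩
  have hvalid := fun {w q S T} h => eval_tripleDFA_valid D₁ D₂ D₃ w (q := q) (S := S) (T := T) h
  by_cases hsurj : ∃ y, D₂.step y a = f₂
  · have ha₂ : Function.Injective (D₂.step · a) := by
      refine Finite.injective_iff_surjective.2 fun z => ?_
      by_cases hz : z = f₂
      · exact hz ▸ hsurj
      obtain ⟨w, hw⟩ := hcompl D₁.start
      obtain ⟨_, _, S₀, -, -, -, hS⟩ := hlast hw hnotMem
      rw [if_neg hs₁, union_empty] at hS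
      obtain ⟨y, -, hy⟩ := mem_image.1 (hS ▸ (by simpa using hz : z ∈ ({f₂}ᶜ : Finset σ₂)))
      exact ⟨y, hy⟩
    have hfa : D₂.step f₂ a ≠ f₂ := by
      intro hfa
      have key : ∀ w q S, (tripleDFA D₁ D₂ D₃).eval w = (q, S, univ) → f₂ ∈ S := by
        intro w
        induction w using List.reverseRecOn with
        | nil =>
          intro q S h
          by_contra hf
          obtain ⟨w', _, _, hw, -⟩ := hlast h hf
          simp at hw
        | append_singleton w x ih =>
          intro q S h
          by_contra hf
          obtain ⟨w', q₀, S₀, hw, hw', -, rfl⟩ := hlast h hf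
          obtain ⟨rfl, -⟩ := List.append_inj' hw rfl
          exact hf (mem_union_left _ (mem_image.2 ⟨f₂, ih _ _ hw', hfa⟩))
      obtain ⟨w, hw⟩ := hcompl D₁.start
      exact hnotMem (key _ _ _ hw)
    have hf₁a : D₁.step f₁ a = f₁ := by
      by_contra hf₁a
      obtain ⟨w, hw⟩ := hreach (D₁.step f₁ a) {D₂.step f₂ a} univ (fun h => absurd h hf₁a)
        (fun _ => mem_univ _) (fun h => absurd h (singleton_ne_empty _))
      obtain ⟨w', q₀, S₀, -, hw', hq, hS⟩ := hlast hw (by simpa using hfa.symm)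
      obtain rfl : q₀ = f₁ := ha₁ hq
      rw [if_neg hf₁a, union_empty] at hS
      have := mem_image_of_mem (D₂.step · a) ((hvalid hw').1 (by simp [hF₁]))
      rw [← hS, mem_singleton] at this
      exact hs₂ (ha₂ this)
    have hs₂a : D₂.step D₂.start a = D₂.start := by
      obtain ⟨w, hw⟩ := hreach f₁ {D₂.start} univ (fun _ => mem_singleton_self _)
        (fun _ => mem_univ _) (fun h => absurd h (singleton_ne_empty _))
      obtain ⟨w', q₀, S₀, -, hw', hq, hS⟩ := hlast hw (by simpa using hs₂.symm)
      obtain rfl : q₀ = f₁ := ha₁ (hq.trans hf₁a.symm)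
      have := mem_union_left (if q₀ = q₀ then {D₂.start} else ∅)
        (mem_image_of_mem (D₂.step · a) ((hvalid hw').1 (by simp [hF₁])))
      rwa [← hS, mem_singleton] at this
    have key : ∀ w q, (tripleDFA D₁ D₂ D₃).eval w ≠ (q, {D₂.start}, univ) := by
      intro w
      induction w using List.reverseRecOn with
      | nil =>
        intro q h
        obtain ⟨w', _, _, hw, -⟩ := hlast h (by simpa using hs₂.symm)
        simp at hw
      | append_singleton w x ih =>
        intro q h
        obtain ⟨w', q₀, S₀, hw, hw', -, hS⟩ := hlast h (by simpa using hs₂.symm)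
        obtain ⟨rfl, -⟩ := List.append_inj' hw rfl
        have hS₀ : S₀ = {D₂.start} := by
          refine eq_singleton_iff_nonempty_unique_mem.2 ⟨?_, fun y hy => ?_⟩
          · exact nonempty_iff_ne_empty.2 fun h0 => hne.ne_empty ((hvalid hw').2.2 h0)
          · have := mem_union_left (if q = f₁ then {D₂.start} else ∅)
              (mem_image_of_mem (D₂.step · a) hy)
            rw [← hS, mem_singleton] at this
            exact ha₂ (this.trans hs₂a.symm)
        exact ih q₀ (hS₀ ▸ hw')
    obtain ⟨w, hw⟩ := hreach D₁.start {D₂.start} univ (fun h => absurd h hs₁)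
      (fun _ => mem_univ _) (fun h => absurd h (singleton_ne_empty _))
    exact key _ _ hw
  · -- Now `f₂` can only be entered by reading `b`.
    have hlast' : ∀ {w S T}, (tripleDFA D₁ D₂ D₃).eval w = (D₁.start, S, T) → f₂ ∈ S →
        ∃ w' q₀ S₀ T₀, (tripleDFA D₁ D₂ D₃).eval w' = (q₀, S₀, T₀) ∧
          S = S₀.image (D₂.step · b) ∧ T = T₀.image (D₃.step · b) ∪ {D₃.start} := by
      intro w S T h hf
      obtain ⟨w', x, q₀, S₀, T₀, -, hw', hq, hS, hT⟩ := exists_predecessor hF₁ hF₂ hs₁ h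
        ⟨_, (hvalid h).2.1 f₂ hf (by simp [hF₂])⟩
      rw [if_neg hs₁, union_empty] at hS
      rw [if_pos hf] at hT
      rcases hab x with rfl | rfl
      · obtain ⟨y, -, hy⟩ := mem_image.1 (hS ▸ hf)
        exact absurd ⟨y, hy⟩ hsurj
      · exact ⟨w', q₀, S₀, T₀, hw', hS, hT⟩
    have hs₃ : ∀ t, D₃.step t b ≠ D₃.start := by
      intro t₀ ht₀
      obtain ⟨w, hw⟩ := hreach D₁.start {f₂} univ (fun h => absurd h hs₁)
        (fun _ => mem_univ _) (fun h => absurd h (singleton_ne_empty _))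
      obtain ⟨_, _, _, T₀, -, -, hT⟩ := hlast' hw (mem_singleton_self _)
      refine hb fun t => ?_
      rcases mem_union.1 (hT ▸ mem_univ t) with ht | ht
      · obtain ⟨t', -, ht'⟩ := mem_image.1 ht
        exact ⟨t', ht'⟩
      · exact ⟨t₀, ht₀.trans (mem_singleton.1 ht).symm⟩
    obtain ⟨w, hw⟩ := hreach D₁.start univ {D₃.start} (fun h => absurd h hs₁)
      (fun _ => mem_singleton_self _) (fun h => absurd (mem_univ f₂) (h ▸ notMem_empty _))
    obtain ⟨w', q₀, S₀, T₀, hw', hS, hT⟩ := hlast' hw (mem_univ _)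
    have hS₀ : S₀ = univ := by
      rw [← card_eq_iff_eq_univ]
      refine le_antisymm (card_le_univ _) ?_
      rw [← card_univ, hS]
      exact card_image_le
    have hmem₀ := (hvalid hw').2.1 f₂ (hS₀ ▸ mem_univ _) (by simp [hF₂])
    have := mem_union_left {D₃.start} (mem_image_of_mem (D₃.step · b) hmem₀)
    rw [← hT, mem_singleton] at this
    exact hs₃ _ this

end Reachability

section Counting

variable {σ₁ σ₂ σ₃ : Type*} [Fintype σ₁] [Fintype σ₂] [Fintype σ₃]

open Classical in
/-- The triples satisfying the constraints imposed by single accepting states `f₁`, `f₂`. -/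
noncomputable def validTriples (f₁ : σ₁) (f₂ s₂ : σ₂) (s₃ : σ₃) :
    Finset (σ₁ × Finset σ₂ × Finset σ₃) :=
  {c | (c.1 = f₁ → s₂ ∈ c.2.1) ∧ (f₂ ∈ c.2.1 → s₃ ∈ c.2.2) ∧ (c.2.1 = ∅ → c.2.2 = ∅)}

open Classical in
theorem card_validTriples_le_sum (f₁ : σ₁) (f₂ s₂ : σ₂) (s₃ : σ₃) :
    #(validTriples f₁ f₂ s₂ s₃) ≤
      (Fintype.card σ₁ - 1) * (1 + (2 ^ (Fintype.card σ₂ - 1) - 1) * 2 ^ Fintype.card σ₃ +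
          2 ^ (Fintype.card σ₂ - 1) * 2 ^ (Fintype.card σ₃ - 1)) +
        (#(Icc {s₂} ({f₂}ᶜ : Finset σ₂)) * 2 ^ Fintype.card σ₃ +
          #(Icc {s₂, f₂} (univ : Finset σ₂)) * 2 ^ (Fintype.card σ₃ - 1)) := by
  have hsub : validTriples f₁ f₂ s₂ s₃ ⊆
      ({f₁}ᶜ ×ˢ ((({∅} : Finset (Finset σ₂)) ×ˢ ({∅} : Finset (Finset σ₃)) ∪
            (Icc ∅ {f₂}ᶜ).erase ∅ ×ˢ univ) ∪
          Icc {f₂} univ ×ˢ Icc {s₃} univ)) ∪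
        ({f₁} ×ˢ (Icc {s₂} {f₂}ᶜ ×ˢ univ ∪ Icc {s₂, f₂} univ ×ˢ Icc {s₃} univ)) := by
    rintro ⟨q, S, T⟩ h
    simp only [validTriples, mem_filter, mem_univ, true_and] at h
    obtain ⟨h₁, h₂, h₃⟩ := h
    simp only [mem_union, mem_product, mem_compl, mem_singleton, mem_erase, mem_Icc, mem_univ,
      empty_subset, subset_univ, singleton_subset_iff, insert_subset_iff,
      subset_compl_singleton, true_and, and_true]
    by_cases hq : q = f₁ <;> by_cases hf : f₂ ∈ S <;> by_cases hS : S = ∅ <;> simp_all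
  refine (card_le_card hsub).trans ((card_union_le _ _).trans (Nat.add_le_add ?_ ?_))
  · rw [card_product, card_compl, card_singleton]
    refine Nat.mul_le_mul_left _ ((card_union_le _ _).trans
      (Nat.add_le_add ((card_union_le _ _).trans (Nat.add_le_add ?_ ?_)) ?_))
    · simp
    · rw [card_product, card_erase_of_mem (by simp), card_Icc_finset (empty_subset _)]
      simp [card_compl]
    · rw [card_product, card_Icc_finset (subset_univ _), card_Icc_finset (subset_univ _)]
      simp
  · rw [card_product, card_singleton, one_mul]
    refine (card_union_le _ _).trans (Nat.add_le_add ?_ ?_)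
    · simp [card_product]
    · rw [card_product, card_Icc_finset (s := {s₃}) (subset_univ _)]
      simp

/-- The bound `B(n₁, n₂, n₃)` on the number of states. -/
def stateBound (n₁ n₂ n₃ : ℕ) : ℕ :=
  (n₁ - 1) * (1 + (2 ^ (n₂ - 1) - 1) * 2 ^ n₃ + 2 ^ (n₂ - 1) * 2 ^ (n₃ - 1)) +
    2 ^ (n₂ - 2) * (2 ^ n₃ + 2 ^ (n₃ - 1))

theorem card_validTriples_le {f₁ : σ₁} {f₂ s₂ : σ₂} {s₃ : σ₃} (h : s₂ ≠ f₂) :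
    #(validTriples f₁ f₂ s₂ s₃) ≤
      stateBound (Fintype.card σ₁) (Fintype.card σ₂) (Fintype.card σ₃) := by
  classical
  refine (card_validTriples_le_sum f₁ f₂ s₂ s₃).trans (Nat.add_le_add_left (le_of_eq ?_) _)
  rw [card_Icc_finset (by simpa using h.symm), card_Icc_finset (subset_univ _), card_pair h,
    card_compl, card_singleton, card_singleton, card_univ, Nat.sub_sub, mul_add]

theorem card_validTriples_lt {f₁ : σ₁} {f₂ : σ₂} {s₃ : σ₃} (h₂ : 2 ≤ Fintype.card σ₂) :
    #(validTriples f₁ f₂ f₂ s₃) <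
      stateBound (Fintype.card σ₁) (Fintype.card σ₂) (Fintype.card σ₃) := by
  classical
  refine (card_validTriples_le_sum f₁ f₂ f₂ s₃).trans_lt (Nat.add_lt_add_left ?_ _)
  rw [Icc_eq_empty (by simp), card_Icc_finset (subset_univ _), pair_eq_singleton,
    card_singleton, card_univ, card_empty, zero_mul, zero_add]
  obtain ⟨m, hm⟩ := Nat.exists_eq_add_of_le h₂
  obtain ⟨k, hk⟩ := Nat.exists_eq_add_of_le (Fintype.card_pos_iff.2 ⟨s₃⟩)
  rw [hm, hk, show 2 + m - 1 = m + 1 by omega, show 2 + m - 2 = m by omega,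
    show 0 + 1 + k - 1 = k by omega, show 0 + 1 + k = k + 1 by omega, pow_succ, pow_succ]
  have := Nat.mul_pos (pow_pos two_pos m) (pow_pos two_pos k)
  nlinarith

end Counting

section Concatenation

theorem one_lt_stateBound {n₁ n₂ n₃ : ℕ} (h₁ : 2 ≤ n₁) :
    1 < stateBound n₁ n₂ n₃ := by
  refine Nat.lt_of_lt_of_le (m := 1 * 1 + 1 * (1 + 1)) (by norm_num)
    (Nat.add_le_add (Nat.mul_le_mul (by omega) (by omega)) (Nat.mul_le_mul ?_ ?_))
  · exact Nat.one_le_two_pow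
  · exact Nat.add_le_add Nat.one_le_two_pow Nat.one_le_two_pow

theorem evalFrom_tripleDFA_univ {α σ₁ σ₂ σ₃ : Type*} [Fintype σ₃] {D₁ : DFA α σ₁}
    {D₂ : DFA α σ₂} {D₃ : DFA α σ₃} (hsurj : ∀ x, Function.Surjective (D₃.step · x))
    {c : σ₁ × Finset σ₂ × Finset σ₃} (hc : c.2.2 = univ) (v : List α) :
    ((tripleDFA D₁ D₂ D₃).evalFrom c v).2.2 = univ := by
  classical
  induction v using List.reverseRecOn with
  | nil => exact hc
  | append_singleton v x ih =>
    rw [DFA.evalFrom_append_singleton]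
    simp only [tripleDFA, saturate] at ih ⊢
    rw [ih, image_univ_of_surjective (hsurj x), union_eq_left.2 (subset_univ _)]

variable {σ₁ σ₂ σ₃ : Type*} [Fintype σ₁] [Fintype σ₂] [Fintype σ₃]
  (D₁ : DFA Bool σ₁) (D₂ : DFA Bool σ₂) (D₃ : DFA Bool σ₃)

theorem ncard_leftQuotient_lt {f₁ : σ₁} {f₂ : σ₂} (hf₁ : f₁ ∈ D₁.accept)
    (hf₂ : f₂ ∈ D₂.accept) (h₁ : 2 ≤ Fintype.card σ₁) (h₂ : 2 ≤ Fintype.card σ₂) :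
    (Set.range (D₁.accepts * D₂.accepts * D₃.accepts).leftQuotient).ncard <
      stateBound (Fintype.card σ₁) (Fintype.card σ₂) (Fintype.card σ₃) := by
  classical
  set C := tripleDFA D₁ D₂ D₃ with hC
  set V := validTriples f₁ f₂ D₂.start D₃.start with hV
  have hmemV : ∀ {q S T}, (q, S, T) ∈ V ↔ (q = f₁ → D₂.start ∈ S) ∧
      (f₂ ∈ S → D₃.start ∈ T) ∧ (S = ∅ → T = ∅) := by
    simp [hV, validTriples]
  have hRV : Set.range C.eval ⊆ V := by
    rintro _ ⟨w, rfl⟩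
    obtain ⟨⟨q, S, T⟩, hw⟩ : ∃ c, C.eval w = c := ⟨_, rfl⟩
    have h := eval_tripleDFA_valid D₁ D₂ D₃ w hw
    rw [hw]
    exact hmemV.2 ⟨fun hq => h.1 (hq ▸ hf₁), fun hf => h.2.1 _ hf hf₂, h.2.2⟩
  rw [← accepts_tripleDFA, Language.leftQuotient_accepts, Set.range_comp, ← hC]
  have hfin : (Set.range C.eval).Finite := V.finite_toSet.subset hRV
  have hle₁ : (C.acceptsFrom '' Set.range C.eval).ncard ≤ (Set.range C.eval).ncard :=
    Set.ncard_image_le hfin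
  have hle₂ : (Set.range C.eval).ncard ≤ #V := by
    rw [← Set.ncard_coe_finset]
    exact Set.ncard_le_ncard hRV V.finite_toSet
  by_contra! hB
  have hs₂ : D₂.start ≠ f₂ := by
    intro h
    have := card_validTriples_lt (f₁ := f₁) (f₂ := f₂) (s₃ := D₃.start) h₂
    rw [hV, h] at hle₂
    omega
  have hle₃ : #V ≤ _ := card_validTriples_le hs₂
  have hinj : Set.InjOn C.acceptsFrom (Set.range C.eval) :=
    Set.injOn_of_ncard_image_eq (by omega) hfin
  have hRV' : Set.range C.eval = V :=
    Set.eq_of_subset_of_ncard_le hRV (by rw [Set.ncard_coe_finset]; omega) V.finite_toSet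
  have hreach : ∀ q S T, (q = f₁ → D₂.start ∈ S) → (f₂ ∈ S → D₃.start ∈ T) →
      (S = ∅ → T = ∅) → ∃ w, C.eval w = (q, S, T) := by
    intro q S T h₁ h₂ h₃
    exact (hRV' ▸ hmemV.2 ⟨h₁, h₂, h₃⟩ : (q, S, T) ∈ Set.range C.eval)
  have : Nontrivial σ₁ := Fintype.one_lt_card_iff_nontrivial.1 h₁
  obtain ⟨q₁, hq₁⟩ := exists_ne f₁
  have hF₁ : D₁.accept = {f₁} := by
    refine Set.eq_singleton_iff_unique_mem.2 ⟨hf₁, fun q hq => ?_⟩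
    by_contra hne
    obtain ⟨w, hw⟩ := hreach q ∅ ∅ (fun h => absurd h hne) (by simp) (by simp)
    simpa using (eval_tripleDFA_valid D₁ D₂ D₃ w hw).1 hq
  have hF₂ : D₂.accept = {f₂} := by
    refine Set.eq_singleton_iff_unique_mem.2 ⟨hf₂, fun s hs => ?_⟩
    by_contra hne
    obtain ⟨w, hw⟩ := hreach q₁ {s} ∅ (fun h => absurd h hq₁)
      (fun h => absurd (mem_singleton.1 h).symm hne) (by simp)
    simpa using (eval_tripleDFA_valid D₁ D₂ D₃ w hw).2.1 s (by simp) hs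
  have hs₁ : D₁.start ≠ f₁ := by
    intro h
    obtain ⟨w, hw⟩ := hreach q₁ ∅ ∅ (fun h => absurd h hq₁) (by simp) (by simp)
    rw [hC, eval_tripleDFA, Prod.mk.injEq, Prod.mk.injEq] at hw
    refine eq_empty_iff_forall_notMem.1 hw.2.1 (D₂.eval w)
      ((mem_suffixStates _ _).2 ⟨[], w, rfl, ?_, rfl⟩)
    rw [DFA.mem_accepts, DFA.eval_nil, h]
    exact hf₁
  obtain ⟨b, hb⟩ : ∃ b, ¬ Function.Surjective (D₃.step · b) := by
    by_contra! hsurj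
    obtain ⟨w, hw⟩ := hreach q₁ {f₂} univ (fun h => absurd h hq₁) (fun _ => mem_univ _)
      (by simp)
    obtain ⟨w', hw'⟩ := hreach q₁ {f₂, D₂.start} univ (fun h => absurd h hq₁)
      (fun _ => mem_univ _) (by simp)
    have heq : C.acceptsFrom (C.eval w) = C.acceptsFrom (C.eval w') := by
      ext v
      rw [DFA.mem_acceptsFrom, DFA.mem_acceptsFrom]
      change (∃ t ∈ (C.evalFrom (C.eval w) v).2.2, _) ↔
        ∃ t ∈ (C.evalFrom (C.eval w') v).2.2, _
      rw [evalFrom_tripleDFA_univ hsurj (by rw [hw]), evalFrom_tripleDFA_univ hsurj (by rw [hw'])]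
    have := hinj ⟨w, rfl⟩ ⟨w', rfl⟩ heq
    rw [hw, hw', Prod.mk.injEq, Prod.mk.injEq] at this
    have hmem : D₂.start ∈ ({f₂} : Finset σ₂) := this.2.1 ▸ by simp
    exact hs₂ (mem_singleton.1 hmem)
  obtain ⟨q, S, T, h₁, h₂, h₃, hw⟩ := exists_unreachable_triple hF₁ hF₂ hs₁ hs₂ hb
  obtain ⟨w, hw'⟩ := hreach q S T h₁ h₂ h₃
  exact hw w hw'

end Concatenation

theorem accepts_eq_zero {α σ : Type*} {M : DFA α σ} (h : M.accept = ∅) : M.accepts = 0 := by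
  ext w
  simp [DFA.mem_accepts, h]

/-- Unreachable states can be added to an automaton. -/
theorem exists_dfa_card_eq {α Q : Type} [Fintype Q] (D : DFA α Q) {n : ℕ}
    (h : Fintype.card Q ≤ n) :
    ∃ (Q' : Type) (_ : Fintype Q') (D' : DFA α Q'),
      D'.accepts = D.accepts ∧ Fintype.card Q' = n := by
  let D' : DFA α (Q ⊕ Fin (n - Fintype.card Q)) :=
    { step := fun q x => q.map (D.step · x) id
      start := .inl D.start
      accept := Sum.inl '' D.accept }
  have heval : ∀ w, D'.eval w = .inl (D.eval w) := by
    intro w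
    induction w using List.reverseRecOn with
    | nil => rfl
    | append_singleton w x ih =>
      rw [DFA.eval_append_singleton, DFA.eval_append_singleton, ih]
      rfl
  refine ⟨_, inferInstance, D', ?_, by simp [h]⟩
  ext w
  rw [DFA.mem_accepts, DFA.mem_accepts, heval]
  simp [D']

end ConcatBinary

/-- Over a binary alphabet, the concatenation of three languages accepted by
DFAs with at most `n₁`, `n₂`, `n₃` states (`nᵢ ≥ 2`) is always accepted by a DFA with strictly
fewer than `B(n₁,n₂,n₃)` states, where
`B(n₁,n₂,n₃) = (n₁−1)·(1+(2^{n₂−1}−1)·2^{n₃}+2^{n₂−1}·2^{n₃−1}) + 2^{n₂−2}·(2^{n₃}+2^{n₃−1})`. -/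
theorem stmt12 (n₁ n₂ n₃ : ℕ) (h₁ : 2 ≤ n₁) (h₂ : 2 ≤ n₂) (h₃ : 2 ≤ n₃)
    (L₁ L₂ L₃ : Language Bool)
    (hL₁ : ∃ (Q : Type) (_ : Fintype Q) (D : DFA Bool Q),
      D.accepts = L₁ ∧ Fintype.card Q ≤ n₁)
    (hL₂ : ∃ (Q : Type) (_ : Fintype Q) (D : DFA Bool Q),
      D.accepts = L₂ ∧ Fintype.card Q ≤ n₂)
    (hL₃ : ∃ (Q : Type) (_ : Fintype Q) (D : DFA Bool Q),
      D.accepts = L₃ ∧ Fintype.card Q ≤ n₃) :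
    ∃ (Q : Type) (_ : Fintype Q) (D : DFA Bool Q),
      D.accepts = L₁ * L₂ * L₃ ∧
      Fintype.card Q <
        (n₁ - 1) * (1 + (2 ^ (n₂ - 1) - 1) * 2 ^ n₃ + 2 ^ (n₂ - 1) * 2 ^ (n₃ - 1))
          + 2 ^ (n₂ - 2) * (2 ^ n₃ + 2 ^ (n₃ - 1)) := by
  obtain ⟨Q₁, _, M₁, rfl, hM₁⟩ := hL₁
  obtain ⟨Q₂, _, M₂, rfl, hM₂⟩ := hL₂
  obtain ⟨Q₃, _, M₃, rfl, hM₃⟩ := hL₃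
  obtain ⟨P₁, _, D₁, hD₁, rfl⟩ := ConcatBinary.exists_dfa_card_eq M₁ hM₁
  obtain ⟨P₂, _, D₂, hD₂, rfl⟩ := ConcatBinary.exists_dfa_card_eq M₂ hM₂
  obtain ⟨P₃, _, D₃, hD₃, rfl⟩ := ConcatBinary.exists_dfa_card_eq M₃ hM₃
  rw [← hD₁, ← hD₂, ← hD₃]
  by_cases hne : D₁.accept.Nonempty ∧ D₂.accept.Nonempty
  · obtain ⟨⟨f₁, hf₁⟩, ⟨f₂, hf₂⟩⟩ := hne
    have hfin : (Set.range (D₁.accepts * D₂.accepts * D₃.accepts).leftQuotient).Finite :=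
      Language.IsRegular.finite_range_leftQuotient
        (Language.isRegular_iff.2 ⟨_, inferInstance, _, ConcatBinary.accepts_tripleDFA D₁ D₂ D₃⟩)
    let := hfin.fintype
    refine ⟨_, this, Language.toDFA _, Language.accepts_toDFA _, ?_⟩
    rw [← Nat.card_eq_fintype_card, Nat.card_coe_set_eq]
    exact ConcatBinary.ncard_leftQuotient_lt D₁ D₂ D₃ hf₁ hf₂ h₁ h₂
  · have hzero : D₁.accepts * D₂.accepts * D₃.accepts = 0 := by
      rw [not_and_or, Set.not_nonempty_iff_eq_empty, Set.not_nonempty_iff_eq_empty] at hne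
      rcases hne with h | h <;> simp [ConcatBinary.accepts_eq_zero h]
    refine ⟨Unit, inferInstance, ⟨fun _ _ => (), (), ∅⟩, ?_, ?_⟩
    · rw [hzero, ConcatBinary.accepts_eq_zero rfl]
    · rw [Fintype.card_unit]
      exact ConcatBinary.one_lt_stateBound h₁
end

section
/- For every k ≥ 3 there exist languages L₁,…,L_k over an alphabet with exactly k letters such that each L_i is accepted by a DFA with 2 states, while every DFA accepting the concatenation L₁L₂⋯L_k has at least B(2,2,…,2) states (the bound B evaluated at n₁ = n₂ = ⋯ = n_k = 2). -/
namespace MultipleConcat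

/-! A subset of the states of a two-state automaton is a pair of Booleans: the first component
records membership of the initial state, the second one membership of the final state. A
configuration assigns such a subset to each automaton. -/

/-- Action of the letter `c` on the subsets of the state set of the `i`-th automaton: it exchanges
the two states if `i` is `c` or `c - 1`, and resets the automaton if `i = c + 1`. -/
def act (c i : ℕ) (p : Bool × Bool) : Bool × Bool :=
  if i = c ∨ i + 1 = c then (p.2, p.1) else if i = c + 1 then (p.1 || p.2, false) else p

/-- The carry into the `i`-th automaton: whether the preceding one reaches its final state. -/
def carry (c : ℕ) (X : ℕ → Bool × Bool) : ℕ → Bool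
  | 0 => false
  | i + 1 => (act c i (X i)).2

/-- The transition of configurations under the letter `c`. -/
def step (c : ℕ) (X : ℕ → Bool × Bool) (i : ℕ) : Bool × Bool :=
  ((act c i (X i)).1 || carry c X i, (act c i (X i)).2)

/-- The configuration reached from `X` by reading a word. -/
def run {k : ℕ} (X : ℕ → Bool × Bool) (w : List (Fin k)) : ℕ → Bool × Bool :=
  w.foldl (fun Y (c : Fin k) => step c Y) X

/-- The configuration in which the automata `0, …, m` are in their initial state, while the others
are not running. -/
def initial (m : ℕ) (i : ℕ) : Bool × Bool := (decide (i ≤ m), false)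

/-- The `i`-th two-state automaton. -/
def machine (k i : ℕ) : DFA (Fin k) Bool where
  step q a := if i = a ∨ i + 1 = a then !q else if i = a + 1 then false else q
  start := false
  accept := {true}

/-- The concatenation of the languages of the first `i` automata. -/
def concat (k : ℕ) : ℕ → Language (Fin k)
  | 0 => 1
  | i + 1 => concat k i * (machine k i).accepts

lemma prod_ofFn_machine (k : ℕ) (m : ℕ) :
    (List.ofFn fun i : Fin m => (machine k i).accepts).prod = concat k m := by
  induction m with
  | zero => simp [concat]
  | succ m ih =>
    rw [List.ofFn_succ_last]
    simp [concat, ← ih]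

/-! ### The configuration automaton recognizes the concatenation -/

/-- The `i`-th automaton may be in the state `q` after reading `w` in the concatenation. -/
def Active (k i : ℕ) (w : List (Fin k)) (q : Bool) : Prop :=
  ∃ u v, w = u ++ v ∧ u ∈ concat k i ∧ (machine k i).eval v = q

lemma mem_concat_succ {k i : ℕ} {w : List (Fin k)} :
    w ∈ concat k (i + 1) ↔ Active k i w true := by
  simp only [concat, Language.mem_mul, Active, DFA.mem_accepts]
  constructor
  · rintro ⟨u, hu, v, hv, rfl⟩
    exact ⟨u, v, rfl, hu, by simpa [machine] using hv⟩
  · rintro ⟨u, v, rfl, hu, hv⟩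
    exact ⟨u, hu, v, by simpa [machine] using hv, rfl⟩

lemma active_append_singleton {k i : ℕ} {w : List (Fin k)} {a : Fin k} {q : Bool} :
    Active k i (w ++ [a]) q ↔
      (∃ p, Active k i w p ∧ (machine k i).step p a = q) ∨
        (q = false ∧ w ++ [a] ∈ concat k i) := by
  constructor
  · rintro ⟨u, v, h, hu, hv⟩
    rcases List.eq_nil_or_concat v with rfl | ⟨v, b, rfl⟩
    · right
      rw [List.append_nil] at h
      exact ⟨by simpa [machine] using hv.symm, h ▸ hu⟩
    · left
      rw [List.concat_eq_append, ← List.append_assoc] at h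
      obtain ⟨rfl, hb⟩ := List.append_inj' h rfl
      obtain rfl : a = b := by simpa using hb
      exact ⟨_, ⟨u, v, rfl, hu, rfl⟩, by simpa using hv⟩
  · rintro (⟨p, ⟨u, v, rfl, hu, rfl⟩, rfl⟩ | ⟨rfl, h⟩)
    · exact ⟨u, v ++ [a], by simp, hu, by simp⟩
    · exact ⟨_, [], by simp, h, rfl⟩

lemma run_append {k : ℕ} (X : ℕ → Bool × Bool) (u v : List (Fin k)) :
    run X (u ++ v) = run (run X u) v := by
  simp [run]

lemma run_initial_iff_active {k : ℕ} (w : List (Fin k)) (i : ℕ) :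
    ((run (initial 0) w i).1 = true ↔ Active k i w false) ∧
      ((run (initial 0) w i).2 = true ↔ Active k i w true) := by
  induction w using List.reverseRecOn generalizing i with
  | nil =>
    have h : ∀ j, [] ∈ concat k j ↔ j = 0 := by
      intro j
      cases j with
      | zero => simp [concat]
      | succ j =>
        simp only [mem_concat_succ, Active, List.nil_eq, List.append_eq_nil_iff]
        simp [machine]
    simp [Active, List.append_eq_nil_iff, h, run, initial, machine]
  | append_singleton w a ih =>
    have hf : ∀ i, (run (initial 0) (w ++ [a]) i).2 = true ↔ Active k i (w ++ [a]) true := by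
      intro i
      rw [active_append_singleton, run_append]
      simp only [Bool.exists_bool, ← (ih i).1, ← (ih i).2]
      simp only [run, List.foldl_cons, List.foldl_nil, step, act, machine]
      split_ifs <;> simp
    refine ⟨?_, hf i⟩
    have hs : w ++ [a] ∈ concat k i ↔ carry a (run (initial 0) w) i = true := by
      cases i with
      | zero => simp [carry, concat]
      | succ i =>
        rw [mem_concat_succ, ← hf, run_append]
        simp [run, step, carry]
    rw [active_append_singleton, run_append, hs]
    simp only [Bool.exists_bool, ← (ih i).1, ← (ih i).2]
    simp only [run, List.foldl_cons, List.foldl_nil, step, act, machine]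
    split_ifs <;> simp

lemma mem_concat_iff_run {k : ℕ} (w : List (Fin k)) (n : ℕ) :
    w ∈ concat k (n + 1) ↔ (run (initial 0) w n).2 = true := by
  rw [mem_concat_succ, (run_initial_iff_active w n).2]

/-! ### Distinguishing configurations -/

/-- The properties shared by all reachable configurations. -/
structure Coherent (X : ℕ → Bool × Bool) : Prop where
  deterministic : (X 0).1 = !(X 0).2
  closed : ∀ i, (X i).2 = true → (X (i + 1)).1 = true

lemma Coherent.step {X : ℕ → Bool × Bool} (h : Coherent X) (c : ℕ) : Coherent (step c X) := by
  refine ⟨?_, fun i hi => ?_⟩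
  · have := h.deterministic
    simp only [MultipleConcat.step, act, carry]
    split_ifs <;> simp_all
  · simp_all [MultipleConcat.step, carry]

lemma coherent_run {k : ℕ} {X : ℕ → Bool × Bool} (h : Coherent X) (w : List (Fin k)) :
    Coherent (run X w) := by
  induction w generalizing X with
  | nil => exact h
  | cons a w ih => exact ih (h.step a)

/-- No word separates the configurations `X` and `Y` when acceptance is decided by the `n`-th
automaton. -/
structure Indist (n : ℕ) (X Y : ℕ → Bool × Bool) : Prop where
  left : Coherent X
  right : Coherent Y
  run_eq : ∀ w : List (Fin (n + 1)), (run X w n).2 = (run Y w n).2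

variable {n : ℕ} {X Y : ℕ → Bool × Bool}

lemma Indist.step (h : Indist n X Y) {c : ℕ} (hc : c ≤ n) :
    Indist n (step c X) (step c Y) :=
  ⟨h.left.step c, h.right.step c, fun w => h.run_eq (⟨c, by omega⟩ :: w)⟩

lemma Indist.last_final (h : Indist n X Y) : (X n).2 = (Y n).2 := h.run_eq []

lemma Indist.last_start (h : Indist n X Y) : (X n).1 = (Y n).1 := by
  simpa [MultipleConcat.step, act] using (h.step le_rfl).last_final

lemma Indist.final_or_prev_start (h : Indist n X Y) {j : ℕ} (hj : j + 1 ≤ n) :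
    ((X (j + 1)).2 || (X j).1) = ((Y (j + 1)).2 || (Y j).1) := by
  obtain ⟨d, rfl⟩ : ∃ d, n = j + 1 + d := ⟨n - (j + 1), by omega⟩
  induction d generalizing j X Y with
  | zero => simpa [MultipleConcat.step, act, carry] using (h.step le_rfl).last_start
  | succ d ih =>
    rw [show j + 1 + (d + 1) = j + 1 + 1 + d by omega] at h
    simpa [MultipleConcat.step, act, carry, show j + 1 + 1 ≠ j by omega] using
      ih (h.step (c := j + 1) (by omega)) (by omega)

lemma Indist.zero_final (h : Indist n X Y) (hn : 1 ≤ n) : (X 0).2 = (Y 0).2 := by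
  simpa [MultipleConcat.step, act, carry] using
    (h.step (c := 0) (by omega)).final_or_prev_start (j := 0) hn

lemma Indist.zero_eq (h : Indist n X Y) (hn : 1 ≤ n) : X 0 = Y 0 := by
  refine Prod.ext ?_ (h.zero_final hn)
  rw [h.left.deterministic, h.right.deterministic, h.zero_final hn]

lemma Indist.one_start (h : Indist n X Y) (hn : 1 ≤ n) : (X 1).1 = (Y 1).1 := by
  have h1 := (h.step hn).final_or_prev_start (j := 0) hn
  have hX := h.left.closed 0
  have hY := h.right.closed 0
  simp [MultipleConcat.step, act, carry] at h1
  grind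

lemma Indist.start_or_final (h : Indist n X Y) {j : ℕ} (hj : j + 2 ≤ n) :
    ((X (j + 2)).1 || (X j).2) = ((Y (j + 2)).1 || (Y j).2) := by
  have h1 := (h.step hj).final_or_prev_start (j := j + 1) hj
  have hX := h.left.closed (j + 1)
  have hY := h.right.closed (j + 1)
  simp [MultipleConcat.step, act, carry] at h1
  grind

lemma Indist.start_eq (h : Indist n X Y) (hn : 2 ≤ n) {j : ℕ} (hj : j ≤ n) :
    (X j).1 = (Y j).1 := by
  match j with
  | 0 => rw [h.zero_eq (by omega)]
  | 1 => exact h.one_start (by omega)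
  | 2 =>
    have h0 := h.zero_eq (by omega)
    have h1 := h.start_or_final (j := 0) hn
    have h2 := (h.step (c := 0) (by omega)).start_or_final (j := 0) hn
    have hX := h.left.deterministic
    have hY := h.right.deterministic
    simp [MultipleConcat.step, act, carry] at h2
    grind
  | j + 3 =>
    have h1 := (h.step (c := j) (by omega)).start_or_final (j := j + 1) hj
    have hX := h.left.closed (j + 2)
    have hY := h.right.closed (j + 2)
    simp [MultipleConcat.step, act, carry] at h1
    grind

lemma Indist.final_or_final (h : Indist n X Y) (hn : 2 ≤ n) {j : ℕ} (hj : j + 2 ≤ n) :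
    ((X (j + 1)).2 || (X j).2) = ((Y (j + 1)).2 || (Y j).2) := by
  simpa [MultipleConcat.step, act, carry, show j ≠ j + 2 + 1 by omega] using
    (h.step (c := j + 2) hj).start_eq hn (j := j + 1) (by omega)

lemma Indist.final_eq (h : Indist n X Y) (hn : 2 ≤ n) {j : ℕ} (hj : j ≤ n) :
    (X j).2 = (Y j).2 := by
  rcases hj.eq_or_lt with rfl | hj
  · exact h.last_final
  match j with
  | 0 => exact h.zero_final (by omega)
  | 1 =>
    have h0 := h.zero_eq (by omega)
    have h1 := h.final_or_final hn (j := 0) hn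
    have h2 := h.final_or_prev_start (j := 0) (by omega)
    have hX := h.left.deterministic
    have hY := h.right.deterministic
    grind
  | j + 2 =>
    simpa [MultipleConcat.step, act, carry, show j + 1 + 1 ≠ j by omega,
      show j + 1 + 1 + 1 ≠ j by omega] using
      (h.step (c := j) (by omega)).final_or_final hn (j := j + 1) (by omega)

lemma Indist.eq (h : Indist n X Y) (hn : 2 ≤ n) {j : ℕ} (hj : j ≤ n) : X j = Y j :=
  Prod.ext (h.start_eq hn hj) (h.final_eq hn hj)

/-! ### Reachable configurations -/

/-- Reachability of configurations by words over the letters less than `m`. -/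
def Reach (m : ℕ) : (ℕ → Bool × Bool) → (ℕ → Bool × Bool) → Prop :=
  Relation.ReflTransGen fun X Y => ∃ c < m, step c X = Y

lemma Reach.mono {m m' : ℕ} (h : Reach m X Y) (hm : m ≤ m') : Reach m' X Y :=
  Relation.ReflTransGen.mono (fun _ _ ⟨c, hc, e⟩ => ⟨c, hc.trans_le hm, e⟩) _ _ h

lemma reach_step (X : ℕ → Bool × Bool) {c m : ℕ} (hc : c < m) : Reach m X (step c X) :=
  .single ⟨c, hc, rfl⟩

lemma Reach.exists_run {k : ℕ} (h : Reach k X Y) : ∃ w : List (Fin k), run X w = Y := by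
  induction h with
  | refl => exact ⟨[], rfl⟩
  | tail _ h ih =>
    obtain ⟨w, rfl⟩ := ih
    obtain ⟨c, hc, rfl⟩ := h
    exact ⟨w ++ [⟨c, hc⟩], by simp [run]⟩

lemma step_ne_empty {c i : ℕ} (h : X i ≠ (false, false)) : step c X i ≠ (false, false) := by
  simp only [step, act]
  split_ifs <;> grind

lemma step_of_lt {c i : ℕ} (hX : ∀ j > c + 1, (X j).2 = false) (hi : c + 1 < i) :
    step c X i = X i := by
  obtain ⟨i, rfl⟩ : ∃ j, i = j + 1 := ⟨i - 1, by omega⟩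
  have : (act c i (X i)).2 = false := by
    rcases (show c + 1 ≤ i by omega).eq_or_lt with rfl | hi
    · simp [act, show c + 1 + 1 ≠ c by omega]
    · rw [← hX i hi]
      simp only [act]
      split_ifs <;> grind
  simp only [step, carry, act]
  split_ifs <;> grind

lemma reach_reset {p : ℕ} (hp : 1 ≤ p) (X : ℕ → Bool × Bool) (h0 : (X 0).1 = !(X 0).2)
    (hne : ∀ i ≤ p, X i ≠ (false, false)) (hgt : ∀ i > p, (X i).2 = false) :
    Reach p X fun i => if i ≤ p then (true, false) else X i := by
  induction p, hp using Nat.le_induction generalizing X with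
  | base =>
    have key : ∀ Z : ℕ → Bool × Bool, Z 0 = (false, true) → Z 1 ≠ (false, false) →
        (∀ i > 1, (Z i).2 = false) →
        step 0 Z = fun i => if i ≤ 1 then (true, false) else Z i := by
      intro Z hZ hZ1 hgt
      funext i
      match i with
      | 0 => simp [step, act, carry, hZ]
      | 1 => simp [step, act, carry, hZ]; grind
      | i + 2 => simp [step_of_lt (X := Z) (c := 0) (i := i + 2) hgt (by omega)]
    have h1 := hne 1 le_rfl
    rcases h : X 0 with ⟨_ | _, _ | _⟩ <;> simp [h] at h0
    · rw [← key X h h1 hgt]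
      exact reach_step _ one_pos
    · have hX : ∀ i > 1, step 0 X i = X i := fun i hi => step_of_lt hgt hi
      have h2 := key (step 0 X) (by simp [step, act, carry, h]) (step_ne_empty h1)
        fun i hi => by rw [hX i hi, hgt i hi]
      have h3 : (fun i => if i ≤ 1 then (true, false) else X i) = step 0 (step 0 X) := by
        rw [h2]
        funext i
        split_ifs with hi
        · rfl
        · rw [hX i (by omega)]
      rw [h3]
      exact (reach_step _ one_pos).trans (reach_step _ one_pos)
  | succ p hp ih =>
    have hX : ∀ i > p + 1, step p X i = X i := fun i hi => step_of_lt hgt hi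
    have hf : (step p X (p + 1)).2 = false := by
      simp [step, act, show p + 1 + 1 ≠ p by omega]
    have hp1 : step p X (p + 1) = (true, false) :=
      Prod.ext (by have := step_ne_empty (c := p) (hne (p + 1) le_rfl); grind) hf
    have h := ih (step p X) (by simp only [step, act, carry]; split_ifs <;> grind)
      (fun i hi => step_ne_empty (hne i (by omega))) fun i hi => by
        rcases (show p + 1 ≤ i from hi).eq_or_lt with rfl | hi
        · exact hf
        · rw [hX i hi, hgt i hi]
    have e : (fun i => if i ≤ p + 1 then (true, false) else X i) =
        fun i => if i ≤ p then (true, false) else step p X i := by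
      funext i
      have := hX i
      grind
    rw [e]
    exact (reach_step X p.lt_succ_self).trans (h.mono p.le_succ)

lemma coherent_initial (m : ℕ) : Coherent (initial m) := ⟨by simp [initial], by simp [initial]⟩

lemma reach_initial (m : ℕ) : Reach m (initial 0) (initial m) := by
  induction m with
  | zero => exact .refl
  | succ m ih =>
    refine (ih.mono m.le_succ).trans ((reach_step _ m.lt_succ_self).trans ?_)
    have hgt : ∀ i > m + 1, step m (initial m) i = (false, false) := fun i hi => by
      rw [step_of_lt (by simp [initial]) hi]
      simp [initial]
      omega
    have e : initial (m + 1) =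
        fun i => if i ≤ m + 1 then (true, false) else step m (initial m) i := by
      funext i
      split_ifs with hi
      · simp [initial, hi]
      · rw [hgt i (by omega)]
        simp [initial, hi]
    rw [e]
    refine reach_reset (by omega) (step m (initial m))
      ((coherent_initial m).step m).deterministic (fun i hi => ?_) (fun i hi => by rw [hgt i hi])
    rcases hi.eq_or_lt with rfl | hi
    · simp [step, carry, act, initial]
    · exact step_ne_empty (by simp [initial]; omega)

/-- Whether the automaton before the `i`-th one is possibly in its final state. -/
def prevFinal (X : ℕ → Bool × Bool) : ℕ → Bool
  | 0 => false
  | i + 1 => (X i).2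

lemma step_swap_left (X : ℕ → Bool × Bool) (n : ℕ) :
    step (n + 1) X n = ((X n).2 || prevFinal X n, (X n).1) := by
  cases n with
  | zero => simp [step, act, carry, prevFinal]
  | succ n =>
    simp [step, act, carry, prevFinal, show n ≠ n + 1 + 1 by omega,
      show n ≠ n + 1 + 1 + 1 by omega]

lemma step_swap_right (X : ℕ → Bool × Bool) (n : ℕ) :
    step (n + 1) X (n + 1) = ((X (n + 1)).2 || (X n).1, (X (n + 1)).1) := by
  simp [step, act, carry]

lemma Coherent.step_of_ne (hX : Coherent X) (h2 : X (n + 2) = (true, false)) {i : ℕ}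
    (hi : i ≠ n) (hi' : i ≠ n + 1) : MultipleConcat.step (n + 1) X i = X i := by
  rcases eq_or_ne i (n + 2) with rfl | hi2
  · simp [MultipleConcat.step, act, h2]
  have h : act (n + 1) i (X i) = X i := by
    simp only [act]
    split_ifs <;> grind
  have hc : carry (n + 1) X i = true → (X i).1 = true := by
    cases i with
    | zero => simp [carry]
    | succ i =>
      intro hc
      refine hX.closed i ?_
      simp only [carry, act] at hc
      split_ifs at hc <;> grind
  refine Prod.ext ?_ ?_ <;> simp only [MultipleConcat.step, h]
  grind

lemma reach_of_coherent (m : ℕ) (hY : ∀ i ≤ m, Y i = (true, false)) (hX : Coherent X)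
    (hne : ∀ i < m, X i ≠ (false, false)) (hXY : ∀ i ≥ m, X i = Y i) : Reach m Y X := by
  induction m using Nat.strong_induction_on generalizing X Y with
  | h m ih =>
  match m with
  | 0 =>
    rw [funext fun i => hXY i i.zero_le]
    exact .refl
  | 1 =>
    have h0 := hX.deterministic
    have h1 := hXY 1 le_rfl
    rcases h : X 0 with ⟨_ | _, _ | _⟩ <;> simp [h] at h0
    · have e : X = step 0 Y := by
        funext i
        match i with
        | 0 => simp [step, act, carry, hY, h]
        | 1 => simp [step, act, carry, hY, h1]
        | i + 2 =>
          have h2 := hX.closed (i + 1)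
          rw [hXY (i + 1) (by omega), hXY (i + 2) (by omega)] at h2
          rw [hXY (i + 2) (by omega)]
          refine Prod.ext ?_ ?_ <;> simp [step, act, carry]
          grind
      rw [e]
      exact reach_step _ one_pos
    · rw [show X = Y from funext fun i => by grind]
      exact .refl
  | n + 2 =>
    have hreplace : ∀ (X Y : ℕ → Bool × Bool) (A : Bool × Bool),
        (∀ i ≤ n + 2, Y i = (true, false)) → Coherent X →
        (∀ i < n + 2, X i ≠ (false, false)) → (∀ i ≥ n + 2, X i = Y i) →
        (prevFinal X n = true → A.1 = true) → A ≠ (false, false) → (n = 0 → A.1 = !A.2) →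
        ∃ Z, Reach (n + 2) Y Z ∧ Coherent Z ∧ Z n = A ∧ Z (n + 1) = (true, false) ∧
          prevFinal Z n = prevFinal X n ∧ Z (n + 2) = (true, false) ∧
          ∀ i, i ≠ n → i ≠ n + 1 → Z i = X i := by
      intro X Y A hY hX hne hXY hA hA' hA0
      set Z : ℕ → Bool × Bool :=
        fun i => if i = n then A else if i = n + 1 then (true, false) else X i with hZ
      have hZc : Coherent Z := by
        refine ⟨?_, fun i => ?_⟩
        · have := hX.deterministic
          grind
        · have := hX.closed i
          rcases eq_or_ne (i + 1) n with rfl | hi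
          · simpa [hZ, prevFinal, show i ≠ i + 1 + 1 by omega] using hA
          · grind
      refine ⟨Z, ?_, hZc, by simp [hZ], by simp [hZ], ?_, ?_, fun i hi hi' => by simp [hZ, hi, hi']⟩
      · refine (ih (n + 1) (by omega) (fun i hi => hY i (by omega)) hZc ?_ ?_).mono (by omega)
        · grind
        · intro i hi
          rcases hi.lt_or_eq with hi | rfl
          · have := hXY i (by omega)
            grind
          · simp [hZ, hY]
      · cases n with
        | zero => simp [prevFinal]
        | succ j => simp [prevFinal, hZ, show j ≠ j + 1 + 1 by omega]
      · simp [hZ, hXY, hY]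
    have hnext : ∀ X Z : ℕ → Bool × Bool, Coherent Z → Z (n + 2) = (true, false) →
        (∀ i, i ≠ n → i ≠ n + 1 → Z i = X i) →
        X n = ((Z n).2 || prevFinal Z n, (Z n).1) →
        X (n + 1) = ((Z (n + 1)).2 || (Z n).1, (Z (n + 1)).1) →
        X = step (n + 1) Z := by
      intro X Z hZ h2 hi h0 h1
      funext i
      rcases eq_or_ne i n with rfl | hn
      · rw [h0, step_swap_left]
      rcases eq_or_ne i (n + 1) with rfl | hn1
      · rw [h1, step_swap_right]
      · rw [hZ.step_of_ne h2 hn hn1, hi i hn hn1]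
    have hone : ∀ (X Y : ℕ → Bool × Bool) (A : Bool × Bool),
        (∀ i ≤ n + 2, Y i = (true, false)) → Coherent X →
        (∀ i < n + 2, X i ≠ (false, false)) → (∀ i ≥ n + 2, X i = Y i) →
        (prevFinal X n = true → A.1 = true) → A ≠ (false, false) → (n = 0 → A.1 = !A.2) →
        X n = (A.2 || prevFinal X n, A.1) → X (n + 1) = (A.1, true) → Reach (n + 2) Y X := by
      intro X Y A hY hX hne hXY hA hA' hA0 h0 h1
      obtain ⟨Z, hr, hZ, rfl, hz1, hzp, hz2, hzX⟩ := hreplace X Y A hY hX hne hXY hA hA' hA0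
      rw [hnext X Z hZ hz2 hzX (by rw [hzp, h0]) (by simp [hz1, h1])]
      exact hr.trans (reach_step _ (by omega))
    have hfree : ∀ X Y : ℕ → Bool × Bool, (∀ i ≤ n + 2, Y i = (true, false)) → Coherent X →
        (∀ i < n + 2, X i ≠ (false, false)) → (∀ i ≥ n + 2, X i = Y i) →
        prevFinal X n = false → (X (n + 1)).2 = true → Reach (n + 2) Y X := by
      intro X Y hY hX hne hXY hp h1
      have hn := hne n (by omega)
      have hc := hX.closed n
      have hd : n = 0 → (X n).1 = !(X n).2 := by rintro rfl; exact hX.deterministic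
      by_cases hs : X n = (true, false) ∧ (X (n + 1)).1 = true
      · obtain ⟨Z, hr, hZ, hz0, hz1, hzp, hz2, hzX⟩ := hreplace X Y (true, false) hY hX hne hXY
          (by simp) (by simp) (by simp)
        have hp' : prevFinal (step (n + 1) Z) n = false := by
          have e : prevFinal (step (n + 1) Z) n = prevFinal Z n := by
            cases n with
            | zero => rfl
            | succ n => simp only [prevFinal, hZ.step_of_ne hz2 (i := n) (by omega) (by omega)]
          rw [e, hzp, hp]
        rw [hnext X (step (n + 1) Z) (hZ.step _)
          (by rw [hZ.step_of_ne hz2 (by omega) (by omega), hz2])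
          (fun i hi hi' => by rw [hZ.step_of_ne hz2 hi hi', hzX i hi hi'])
          (by rw [step_swap_left, hp']; simp [hz0, hzp, hp, hs.1])
          (by rw [step_swap_left, step_swap_right]; simp [hz0, hz1, hzp, hp]; grind)]
        exact (hr.trans (reach_step _ (by omega))).trans (reach_step _ (by omega))
      · refine hone X Y ((X n).2, (X n).1) hY hX hne hXY (by simp [hp]) ?_ ?_ (by simp [hp]) ?_
        · grind
        · grind
        · have key : ∀ a b : Bool × Bool, a ≠ (false, false) → (a.2 = true → b.1 = true) →
              ¬(a = (true, false) ∧ b.1 = true) → b.1 = a.2 := by decide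
          exact Prod.ext (key _ _ hn hc hs) h1
    by_cases h1 : (X (n + 1)).2 = true
    · cases hp : prevFinal X n with
      | false => exact hfree X Y hY hX hne hXY hp h1
      | true =>
        obtain ⟨j, rfl⟩ : ∃ j, n = j + 1 := by
          cases n with
          | zero => simp [prevFinal] at hp
          | succ j => exact ⟨j, rfl⟩
        have hn : (X (j + 1)).1 = true := hX.closed j hp
        cases hn2 : (X (j + 1)).2 with
        | true =>
          have := hX.closed (j + 1) hn2
          exact hone X Y (true, false) hY hX hne hXY (by simp) (by simp) (by simp)
            (by simp [hp, Prod.ext_iff, hn, hn2]) (Prod.ext this h1)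
        | false =>
          set W : ℕ → Bool × Bool := fun i => if i ≤ j + 1 then (true, false) else X i with hW
          have hWc : Coherent W := by
            refine ⟨by simp [hW], fun i => ?_⟩
            have := hX.closed i
            grind
          have hr : Reach (j + 1 + 2) Y W :=
            hfree W Y hY hWc (by grind) (by grind) (by simp [prevFinal, hW]) (by simpa [hW] using h1)
          refine hr.trans ((ih (j + 1) (by omega) (by grind) hX (fun i hi => hne i (by omega))
            ?_).mono (by omega))
          intro i hi
          rcases hi.lt_or_eq with hi | rfl
          · grind
          · simp [hW, Prod.ext_iff, hn, hn2]
    · refine (ih (n + 1) (by omega) (fun i hi => hY i (by omega)) hX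
        (fun i hi => hne i (by omega)) fun i hi => ?_).mono (by omega)
      rcases hi.lt_or_eq with hi | rfl
      · exact hXY i hi
      · have := hne (n + 1) (by omega)
        rw [hY _ (by omega)]
        have key : ∀ a : Bool × Bool, ¬a.2 = true → a ≠ (false, false) → a = (true, false) := by
          decide
        exact key _ h1 this

/-! ### Counting configurations -/

/-- The realizable ways in which the last `n` automata can be running; the flag tells whether the
first of them is forced to be in its initial state. -/
def tails : ℕ → Bool → Finset (List (Bool × Bool))
  | 0, _ => {[]}
  | n + 1, b =>
    (tails n false).image (List.cons (true, false)) ∪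
      (tails n true).image (List.cons (true, true)) ∪
      if b then ∅
      else (tails n true).image (List.cons (false, true)) ∪
        {List.replicate (n + 1) (false, false)}

lemma UV_replicate_succ (n : ℕ) :
    UV (List.replicate (n + 1) 2) =
      (1 + (UV (List.replicate n 2)).1 + 2 * (UV (List.replicate n 2)).2,
        (UV (List.replicate n 2)).1 + (UV (List.replicate n 2)).2) := by
  cases n <;> simp [List.replicate_succ, UV]

lemma card_image_cons_union {α : Type*} [DecidableEq α] {a b : α} (hab : a ≠ b)
    (s t : Finset (List α)) :
    (s.image (List.cons a) ∪ t.image (List.cons b)).card = s.card + t.card := by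
  rw [Finset.card_union_of_disjoint, Finset.card_image_of_injective _ List.cons_injective,
    Finset.card_image_of_injective _ List.cons_injective]
  rw [Finset.disjoint_left]
  simp only [Finset.mem_image]
  rintro _ ⟨l, _, rfl⟩ ⟨l', _, h⟩
  exact hab (List.cons.inj h).1.symm

lemma card_tails (n : ℕ) :
    (tails n false).card = (UV (List.replicate n 2)).1 ∧
      (tails n true).card = (UV (List.replicate n 2)).2 := by
  induction n with
  | zero => simp [tails, UV]
  | succ n ih =>
    rw [UV_replicate_succ]
    refine ⟨?_, by simp [tails, card_image_cons_union, ih]⟩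
    simp only [tails, Bool.false_eq_true, if_false]
    rw [Finset.card_union_of_disjoint, card_image_cons_union (by simp),
      Finset.card_union_of_disjoint, Finset.card_image_of_injective _ List.cons_injective,
      Finset.card_singleton, ih.1, ih.2]
    · ring
    · simp [List.replicate_succ]
    · rw [Finset.disjoint_left]
      simp only [Finset.mem_union, Finset.mem_image, Finset.mem_singleton, List.replicate_succ]
      rintro _ (⟨l, _, rfl⟩ | ⟨l, _, rfl⟩) (⟨l', _, h⟩ | h) <;> simp at h

lemma exists_config_of_mem_tails {n : ℕ} {b : Bool} {l : List (Bool × Bool)} (hl : l ∈ tails n b)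
    {c : Bool × Bool} (hc : c ≠ (false, false)) (hb : b = false → c = (true, false)) :
    l.length = n ∧ ∃ m ≤ n + 1, ∃ X : ℕ → Bool × Bool, X 0 = c ∧
      (∀ i < n, X (i + 1) = l.getD i (false, false)) ∧ (∀ i < m, X i ≠ (false, false)) ∧
      (∀ i, (X i).2 = true → (X (i + 1)).1 = true) ∧ ∀ i ≥ m, X i = initial m i := by
  induction n generalizing b l c with
  | zero =>
    simp only [tails, Finset.mem_singleton] at hl
    subst hl
    refine ⟨rfl, 1, le_rfl, fun i => if i = 0 then c else initial 1 i, ?_⟩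
    simp [initial]
    grind
  | succ n ih =>
    have hcons : ∀ (b' : Bool) (c' : Bool × Bool) (l' : List (Bool × Bool)), l' ∈ tails n b' →
        c' ≠ (false, false) → (b' = false → c' = (true, false)) → (c.2 = true → c'.1 = true) →
        (c' :: l').length = n + 1 ∧ ∃ m ≤ n + 1 + 1, ∃ X : ℕ → Bool × Bool, X 0 = c ∧
          (∀ i < n + 1, X (i + 1) = (c' :: l').getD i (false, false)) ∧
          (∀ i < m, X i ≠ (false, false)) ∧
          (∀ i, (X i).2 = true → (X (i + 1)).1 = true) ∧ ∀ i ≥ m, X i = initial m i := by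
      intro b' c' l' hl' hc' hb' hcc'
      obtain ⟨hlen, m, hm, X, hX0, hXl, hXne, hXc, hXm⟩ := ih hl' hc' hb'
      refine ⟨by simp [hlen], m + 1, by omega, fun i => i.casesOn c X, rfl, ?_, ?_, ?_, ?_⟩
      · rintro (_ | i) hi
        · simpa using hX0
        · simpa using hXl i (by omega)
      · rintro (_ | i) hi
        · exact hc
        · exact hXne i (by omega)
      · rintro (_ | i) hi
        · have := hcc' hi
          rw [← hX0] at this
          exact this
        · exact hXc i hi
      · rintro (_ | i) hi
        · omega
        · simpa [initial] using hXm i (by omega)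
    simp only [tails, Finset.mem_union, Finset.mem_image] at hl
    rcases hl with (⟨l, hl, rfl⟩ | ⟨l, hl, rfl⟩) | hl
    · exact hcons _ _ _ hl (by simp) (by simp) (by simp)
    · exact hcons _ _ _ hl (by simp) (by simp) (by simp)
    · cases b with
      | true => simp at hl
      | false =>
        obtain rfl := hb rfl
        simp only [Bool.false_eq_true, if_false, Finset.mem_union, Finset.mem_image,
          Finset.mem_singleton] at hl
        rcases hl with ⟨l, hl, rfl⟩ | rfl
        · exact hcons _ _ _ hl (by simp) (by simp) (by simp)
        · refine ⟨by simp, 0, by omega, initial 0, by simp [initial], ?_, by simp,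
            by simp [initial], fun _ _ => rfl⟩
          intro i hi
          simp [initial, hi]

/-- The configurations of the first `n + 1` automata. -/
def configs (n : ℕ) : Finset (List (Bool × Bool)) :=
  (tails n false).image (List.cons (true, false)) ∪ (tails n true).image (List.cons (false, true))

lemma card_configs (n : ℕ) : (configs n).card = Bval 2 (List.replicate n 2) := by
  rw [configs, card_image_cons_union (by simp), (card_tails n).1, (card_tails n).2]
  simp [Bval]

lemma exists_run_of_mem_configs {n : ℕ} {l : List (Bool × Bool)} (hl : l ∈ configs n) :
    l.length = n + 1 ∧ ∃ w : List (Fin (n + 1)),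
      ∀ i ≤ n, run (initial 0) w i = l.getD i (false, false) := by
  have key : ∀ (b : Bool) (c : Bool × Bool) (l : List (Bool × Bool)), l ∈ tails n b →
      c.1 = !c.2 → (b = false → c = (true, false)) →
      (c :: l).length = n + 1 ∧ ∃ w : List (Fin (n + 1)),
        ∀ i ≤ n, run (initial 0) w i = (c :: l).getD i (false, false) := by
    intro b c l hl hc hb
    obtain ⟨hlen, m, hm, X, hX0, hXl, hXne, hXc, hXm⟩ :=
      exists_config_of_mem_tails hl (c := c) (by rintro rfl; simp at hc) hb
    have hr : Reach m (initial m) X :=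
      reach_of_coherent m (fun i hi => by simp [initial, hi]) ⟨hX0 ▸ hc, hXc⟩ hXne hXm
    obtain ⟨w, rfl⟩ :=
      Reach.exists_run (Reach.mono (Relation.ReflTransGen.trans (reach_initial m) hr) hm)
    refine ⟨by simp [hlen], w, ?_⟩
    rintro (_ | i) hi
    · simpa using hX0
    · simpa using hXl i (by omega)
  simp only [configs, Finset.mem_union, Finset.mem_image] at hl
  rcases hl with ⟨l, hl, rfl⟩ | ⟨l, hl, rfl⟩
  · exact key _ _ _ hl (by simp) (by simp)
  · exact key _ _ _ hl (by simp) (by simp)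

lemma Bval_le_card {n : ℕ} (hn : 2 ≤ n) {Q : Type*} [Fintype Q] (D : DFA (Fin (n + 1)) Q)
    (hD : D.accepts = concat (n + 1) (n + 1)) : Bval 2 (List.replicate n 2) ≤ Fintype.card Q := by
  have hex : ∀ l : List (Bool × Bool), ∃ w : List (Fin (n + 1)), l ∈ configs n →
      ∀ i ≤ n, run (initial 0) w i = l.getD i (false, false) := by
    intro l
    by_cases hl : l ∈ configs n
    · obtain ⟨-, w, hw⟩ := exists_run_of_mem_configs hl
      exact ⟨w, fun _ => hw⟩
    · exact ⟨[], fun h => absurd h hl⟩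
  choose w hw using hex
  rw [← card_configs, ← Finset.card_univ]
  refine Finset.card_le_card_of_injOn (fun l => D.eval (w l)) (by simp) ?_
  intro l hl l' hl' h
  have hind : Indist n (run (initial 0) (w l)) (run (initial 0) (w l')) := by
    refine ⟨coherent_run (coherent_initial 0) _, coherent_run (coherent_initial 0) _,
      fun v => ?_⟩
    rw [Bool.eq_iff_iff, ← run_append, ← run_append, ← mem_concat_iff_run, ← mem_concat_iff_run,
      ← hD, DFA.mem_accepts, DFA.mem_accepts, DFA.eval, DFA.evalFrom_of_append,
      DFA.evalFrom_of_append]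
    exact iff_of_eq (congrArg (fun q => D.evalFrom q v ∈ D.accept) h)
  have hlen := (exists_run_of_mem_configs hl).1
  have hlen' := (exists_run_of_mem_configs hl').1
  refine List.ext_getElem (by omega) fun i hi hi' => ?_
  have := hind.eq hn (show i ≤ n by omega)
  rw [hw l hl i (by omega), hw l' hl' i (by omega)] at this
  simpa [List.getD_eq_getElem, hi, hi'] using this

end MultipleConcat

/-- For every `k ≥ 3` there are languages over an alphabet with exactly `k`
letters, each accepted by a two-state DFA, whose concatenation needs at least `B(2,2,…,2)`
states. -/
theorem stmt13 (k : ℕ) (hk : 3 ≤ k) :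
    ∃ L : Fin k → Language (Fin k),
      (∀ i, ∃ (Q : Type) (_ : Fintype Q) (D : DFA (Fin k) Q),
        D.accepts = L i ∧ Fintype.card Q = 2) ∧
      (∀ (Q : Type) (inst : Fintype Q) (D : DFA (Fin k) Q),
        D.accepts = (List.ofFn L).prod →
        Bval 2 (List.replicate (k - 1) 2) ≤ @Fintype.card Q inst) := by
  obtain ⟨n, rfl⟩ : ∃ n, k = n + 1 := ⟨k - 1, by omega⟩
  refine ⟨fun i => (MultipleConcat.machine (n + 1) i).accepts,
    fun i => ⟨Bool, inferInstance, _, rfl, Fintype.card_bool⟩, fun Q inst D hD => ?_⟩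
  rw [MultipleConcat.prod_ofFn_machine] at hD
  exact MultipleConcat.Bval_le_card (by omega) D hD
end

section
/- For every k ≥ 3 and all integers n₁ ≥ 3, n₂ ≥ 4, and n_i ≥ 3 for 3 ≤ i ≤ k, there exist languages L₁,…,L_k over a two-letter alphabet such that each L_i is accepted by a DFA with n_i states, while every DFA accepting the concatenation L₁L₂⋯L_k has at least n₁ − 1 + 2^{(n₂+n₃+⋯+n_k) − (2k−2)} states. -/
/-- The words of length exactly `c`. -/
def exactLength (c : ℕ) : Language Bool := {w | w.length = c}

/-- The words of length greater than `m` that end in `true`. -/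
def longEndingTrue (m : ℕ) : Language Bool := {w | m < w.length ∧ w.getLast? = some true}

/-- Counts letters up to `c + 1`. -/
def exactLengthDFA (c : ℕ) : DFA Bool (Fin (c + 2)) where
  step s _ := ⟨min (s + 1) (c + 1), by omega⟩
  start := 0
  accept := {s | s.val = c}

theorem exactLengthDFA_eval (c : ℕ) (w : List Bool) :
    ((exactLengthDFA c).eval w).val = min w.length (c + 1) := by
  induction w using List.reverseRecOn with
  | nil => simp [exactLengthDFA]
  | append_singleton w b ih =>
    rw [DFA.eval_append_singleton, List.length_append, List.length_singleton]
    simp only [exactLengthDFA] at ih ⊢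
    omega

theorem exactLengthDFA_accepts (c : ℕ) : (exactLengthDFA c).accepts = exactLength c := by
  ext w
  change ((exactLengthDFA c).eval w).val = c ↔ w.length = c
  rw [exactLengthDFA_eval]
  omega

/-- Counts letters up to `m`, then remembers whether the last letter was `true`. -/
def longEndingTrueDFA (m : ℕ) : DFA Bool (Fin (m + 2)) where
  step s b :=
    if h : s.val < m then ⟨s + 1, by omega⟩ else if b then ⟨m + 1, by omega⟩ else ⟨m, by omega⟩
  start := 0
  accept := {s | s.val = m + 1}

theorem longEndingTrueDFA_eval (m : ℕ) (w : List Bool) :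
    ((longEndingTrueDFA m).eval w).val =
      if m < w.length ∧ w.getLast? = some true then m + 1 else min w.length m := by
  induction w using List.reverseRecOn with
  | nil => simp [longEndingTrueDFA]
  | append_singleton w b ih =>
    rw [DFA.eval_append_singleton, List.length_append, List.length_singleton,
      List.getLast?_concat]
    generalize (longEndingTrueDFA m).eval w = s at ih ⊢
    simp only [longEndingTrueDFA]
    cases b <;> grind

theorem longEndingTrueDFA_accepts (m : ℕ) :
    (longEndingTrueDFA m).accepts = longEndingTrue m := by
  ext w
  change ((longEndingTrueDFA m).eval w).val = m + 1 ↔ m < w.length ∧ w.getLast? = some true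
  rw [longEndingTrueDFA_eval]
  split_ifs with h
  · simp [h]
  · simp only [h, iff_false]
    omega

theorem exactLength_mul (c d : ℕ) : exactLength c * exactLength d = exactLength (c + d) := by
  ext w
  rw [Language.mem_mul]
  constructor
  · rintro ⟨u, rfl, v, rfl, rfl⟩
    exact List.length_append
  · intro (h : w.length = c + d)
    refine ⟨w.take c, ?_, w.drop c, ?_, List.take_append_drop c w⟩
    · change (w.take c).length = c
      simp [h]
    · change (w.drop c).length = d
      simp [h]

theorem prod_ofFn_exactLength {k : ℕ} (c : Fin k → ℕ) :
    (List.ofFn fun i => exactLength (c i)).prod = exactLength (∑ i, c i) := by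
  induction k with
  | zero =>
    ext w
    simp only [List.ofFn_zero, List.prod_nil, Finset.univ_eq_empty, Finset.sum_empty,
      Language.mem_one]
    exact List.length_eq_zero_iff.symm
  | succ k ih =>
    rw [List.ofFn_succ, List.prod_cons, ih, exactLength_mul, Fin.sum_univ_succ]

theorem mem_longEndingTrue_mul_exactLength (m N : ℕ) (w : List Bool) :
    w ∈ longEndingTrue m * exactLength N ↔
      m + N < w.length ∧ w[w.length - 1 - N]? = some true := by
  rw [Language.mem_mul]
  constructor
  · rintro ⟨u, ⟨hm, hu⟩, v, rfl, rfl⟩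
    rw [List.getLast?_eq_getElem?] at hu
    rw [List.length_append, List.getElem?_append_left (by omega)]
    refine ⟨by omega, ?_⟩
    rwa [show u.length + v.length - 1 - v.length = u.length - 1 by omega]
  · rintro ⟨hl, hw⟩
    refine ⟨w.take (w.length - N), ⟨?_, ?_⟩, w.drop (w.length - N), ?_, List.take_append_drop _ w⟩
    · rw [List.length_take]
      omega
    · rw [List.getLast?_eq_getElem?, List.length_take, List.getElem?_take_of_lt (by omega), ← hw]
      congr 1
      omega
    · change (w.drop _).length = N
      rw [List.length_drop]
      omega

/-- Pairwise inequivalent words for the language `longEndingTrue m * exactLength N`. -/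
def inequivalentWord (m N : ℕ) : Fin m ⊕ (Fin (N + 1) → Bool) → List Bool
  | .inl j => List.replicate j false
  | .inr x => List.replicate m false ++ List.ofFn x

theorem inequivalentWord_injective (m N : ℕ) (p q : Fin m ⊕ (Fin (N + 1) → Bool))
    (h : ∀ z, inequivalentWord m N p ++ z ∈ longEndingTrue m * exactLength N ↔
      inequivalentWord m N q ++ z ∈ longEndingTrue m * exactLength N) : p = q := by
  simp only [mem_longEndingTrue_mul_exactLength] at h
  have short (i : ℕ) (hi : i < m) (u : List Bool) (hu : i < u.length)
      (hum : u.length ≤ m + N + 1) :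
      ¬ ∀ z, (m + N < (List.replicate i false ++ z).length ∧
          (List.replicate i false ++ z)[(List.replicate i false ++ z).length - 1 - N]? =
            some true) ↔
        (m + N < (u ++ z).length ∧ (u ++ z)[(u ++ z).length - 1 - N]? = some true) := by
    intro h
    have := (h (List.replicate (m + N - i) true)).2
    have hlen : u.length ≤ (u ++ List.replicate (m + N - i) true).length - 1 - N := by
      simp only [List.length_append, List.length_replicate]
      omega
    rw [List.getElem?_append_right hlen, List.getElem?_replicate] at this
    simp only [List.length_append, List.length_replicate] at this
    grind
  rcases p with i | x <;> rcases q with j | y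
  · rcases lt_trichotomy i j with hij | hij | hij
    · exact (short i i.2 _ (by simpa [inequivalentWord] using hij)
        (by simp [inequivalentWord]; omega) h).elim
    · rw [hij]
    · exact (short j j.2 _ (by simpa [inequivalentWord] using hij)
        (by simp [inequivalentWord]; omega) fun z => (h z).symm).elim
  · exact (short i i.2 _ (by simp [inequivalentWord]; omega)
      (by simp [inequivalentWord]; omega) h).elim
  · exact (short j j.2 _ (by simp [inequivalentWord]; omega)
      (by simp [inequivalentWord]; omega) fun z => (h z).symm).elim
  · congr 1
    funext i
    have key (x : Fin (N + 1) → Bool) :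
        let w := inequivalentWord m N (.inr x) ++ List.replicate i false
        (m + N < w.length ∧ w[w.length - 1 - N]? = some true) ↔ x i = true := by
      intro w
      have hlen : w.length = m + (N + 1) + i := by
        simp [w, inequivalentWord, add_assoc, -List.ofFn_succ]
      rw [hlen, show m + (N + 1) + i.val - 1 - N = m + i by omega]
      have hget : w[m + i.val]? = some (x i) := by
        simp only [w, inequivalentWord, List.append_assoc]
        rw [List.getElem?_append_right (by simp),
          List.getElem?_append_left (by simp [-List.ofFn_succ]; omega)]
        simp [-List.ofFn_succ, Nat.le_of_lt_succ i.2]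
      rw [hget, Option.some_inj]
      exact and_iff_right (by omega)
    exact Bool.eq_iff_iff.2 (((key x).symm.trans (h _)).trans (key y))

theorem card_ge_of_accepts_longEndingTrue_mul_exactLength {m N : ℕ} {Q : Type*} [Fintype Q]
    (D : DFA Bool Q) (hD : D.accepts = longEndingTrue m * exactLength N) :
    m + 2 ^ (N + 1) ≤ Fintype.card Q := by
  have hinj : Function.Injective fun p => D.eval (inequivalentWord m N p) := by
    intro p q hpq
    refine inequivalentWord_injective m N p q fun z => ?_
    rw [← hD, DFA.mem_accepts, DFA.mem_accepts, DFA.eval, DFA.evalFrom_of_append,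
      DFA.evalFrom_of_append]
    exact iff_of_eq (congrArg (fun s => D.evalFrom s z ∈ D.accept) hpq)
  simpa using Fintype.card_le_of_injective _ hinj


/-- For every `k ≥ 3`, `n₁ ≥ 3`, `n₂ ≥ 4` and `nᵢ ≥ 3` for `3 ≤ i ≤ k`,
there are languages over a binary alphabet, each accepted by a DFA with `nᵢ` states, whose
concatenation needs at least `n₁ − 1 + 2^{(n₂+⋯+n_k)−(2k−2)}` states. -/
theorem stmt14 (k : ℕ) (hk : 3 ≤ k) (n : Fin k → ℕ)
    (h1 : 3 ≤ n ⟨0, Nat.lt_of_lt_of_le (Nat.zero_lt_succ 2) hk⟩)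
    (h2 : 4 ≤ n ⟨1, Nat.lt_of_lt_of_le (Nat.one_lt_succ_succ 1) hk⟩)
    (h3 : ∀ i : Fin k, 2 ≤ i.val → 3 ≤ n i) :
    ∃ L : Fin k → Language Bool,
      (∀ i, ∃ (Q : Type) (_ : Fintype Q) (D : DFA Bool Q),
        D.accepts = L i ∧ Fintype.card Q = n i) ∧
      (∀ (Q : Type) (inst : Fintype Q) (D : DFA Bool Q),
        D.accepts = (List.ofFn L).prod →
        n ⟨0, Nat.lt_of_lt_of_le (Nat.zero_lt_succ 2) hk⟩ - 1 +
            2 ^ ((∑ i ∈ Finset.univ.erase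
                (⟨0, Nat.lt_of_lt_of_le (Nat.zero_lt_succ 2) hk⟩ : Fin k), n i) - (2 * k - 2))
          ≤ @Fintype.card Q inst) := by
  obtain ⟨k, rfl⟩ : ∃ l, k = l + 1 := ⟨k - 1, by omega⟩
  change 3 ≤ n 0 at h1
  have hn (i : Fin (k + 1)) : 2 ≤ n i := by
    rcases Nat.lt_or_ge i.val 2 with hi | hi
    · obtain h | h : i = ⟨0, by omega⟩ ∨ i = ⟨1, by omega⟩ := by
        simp only [Fin.ext_iff]
        omega
      · rw [h]
        exact le_trans (by norm_num) h1
      · rw [h]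
        exact le_trans (by norm_num) h2
    · exact le_trans (by norm_num) (h3 i hi)
  refine ⟨Fin.cons (longEndingTrue (n 0 - 2)) fun i => exactLength (n i.succ - 2),
    fun i => ?_, fun Q inst D hD => ?_⟩
  · refine i.cases ?_ fun i => ?_
    · exact ⟨_, inferInstance, longEndingTrueDFA (n 0 - 2), longEndingTrueDFA_accepts _, by
        rw [Fintype.card_fin, Nat.sub_add_cancel (hn 0)]⟩
    · exact ⟨_, inferInstance, exactLengthDFA (n i.succ - 2), exactLengthDFA_accepts _, by
        rw [Fintype.card_fin, Nat.sub_add_cancel (hn i.succ)]⟩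
  · have hsum : (∑ i ∈ Finset.univ.erase (0 : Fin (k + 1)), n i) - (2 * (k + 1) - 2) =
        ∑ i : Fin k, (n i.succ - 2) := by
      have herase := Finset.add_sum_erase Finset.univ n (Finset.mem_univ 0)
      have hsub : ∑ i : Fin k, (n i.succ - 2) + k * 2 = ∑ i : Fin k, n i.succ := by
        rw [← Finset.sum_congr rfl fun i _ => Nat.sub_add_cancel (hn (Fin.succ i)),
          Finset.sum_add_distrib]
        simp
      rw [Fin.sum_univ_succ] at herase
      omega
    rw [List.ofFn_succ, List.prod_cons] at hD
    simp only [Fin.cons_zero, Fin.cons_succ] at hD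
    rw [prod_ofFn_exactLength] at hD
    have hcard := card_ge_of_accepts_longEndingTrue_mul_exactLength D hD
    change n 0 - 1 + 2 ^ ((∑ i ∈ Finset.univ.erase (0 : Fin (k + 1)), n i) - (2 * (k + 1) - 2)) ≤ _
    rw [hsum]
    rw [pow_succ] at hcard
    have hpos := Nat.one_le_two_pow (n := ∑ i : Fin k, (n i.succ - 2))
    omega
end
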